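/- arXiv:math/0506317 — 2 statements merged into one kernel-verified Lean document; each statement's English description precedes it below -/
import Mathlib

section
/- The growth constant of three-choice walks is exactly 2: if w_n denotes the number of three-choice walks of n steps starting at the origin, then lim_{n→∞} w_n^{1/n} = 2 (equivalently, w_n = 2^{n + o(n)}). -/
/-- A directed lattice path of `n` steps: each step is a unit step east or north. -/
def IsDirectedPath (n : ℕ) (p : Fin (n + 1) → ℤ × ℤ) : Prop :=
  ∀ i : Fin n, p i.succ - p i.castSucc = (1, 0) ∨ p i.succ - p i.castSucc = (0, 1)

/-- `p, q` form a staircase polygon of half-perimeter `n`: two distinct directed paths of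
`n` steps, both starting at the origin, ending at the same point, and sharing no
vertices other than their common start and end. -/
def IsStaircasePair (n : ℕ) (p q : Fin (n + 1) → ℤ × ℤ) : Prop :=
  IsDirectedPath n p ∧ IsDirectedPath n q ∧
  p 0 = (0, 0) ∧ q 0 = (0, 0) ∧ p ≠ q ∧
  p (Fin.last n) = q (Fin.last n) ∧
  ∀ i j : Fin (n + 1), p i = q j →
    (i = 0 ∧ j = 0) ∨ (i = Fin.last n ∧ j = Fin.last n)

/-- The number of staircase polygons of half-perimeter `n`, counted as unordered pairs. -/
noncomputable def staircaseCount (n : ℕ) : ℕ :=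
  Nat.card {s : Sym2 (Fin (n + 1) → ℤ × ℤ) //
    ∃ p q, s = s(p, q) ∧ IsStaircasePair n p q}

/-- The `i`-th step of a walk. -/
def walkStep (n : ℕ) (w : Fin (n + 1) → ℤ × ℤ) (i : Fin n) : ℤ × ℤ :=
  w i.succ - w i.castSucc

/-- The three-choice condition: a step immediately following an east step is east or
north, and a step immediately following a west step is west or south. -/
def ThreeChoiceCond (n : ℕ) (w : Fin (n + 1) → ℤ × ℤ) : Prop :=
  ∀ i j : Fin n, (j : ℕ) = (i : ℕ) + 1 →
    (walkStep n w i = (1, 0) → walkStep n w j = (1, 0) ∨ walkStep n w j = (0, 1)) ∧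
    (walkStep n w i = (-1, 0) → walkStep n w j = (-1, 0) ∨ walkStep n w j = (0, -1))

/-- A three-choice walk of `n` steps: a self-avoiding walk on `ℤ²` starting at the
origin with unit steps, satisfying the three-choice condition. -/
def IsThreeChoiceWalk (n : ℕ) (w : Fin (n + 1) → ℤ × ℤ) : Prop :=
  w 0 = (0, 0) ∧
  (∀ i : Fin n, walkStep n w i ∈ ({(1, 0), (-1, 0), (0, 1), (0, -1)} : Set (ℤ × ℤ))) ∧
  Function.Injective w ∧
  ThreeChoiceCond n w

/-- The number of three-choice walks of `n` steps. -/
noncomputable def threeChoiceWalkCount (n : ℕ) : ℕ :=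
  Nat.card {w : Fin (n + 1) → ℤ × ℤ // IsThreeChoiceWalk n w}

/-- A three-choice polygon of perimeter `2n`: a three-choice walk of `2n` steps ending at
the origin, visiting no vertex twice except that its first vertex equals its last. -/
def IsThreeChoicePolygon (n : ℕ) (w : Fin (2 * n + 1) → ℤ × ℤ) : Prop :=
  w 0 = (0, 0) ∧ w (Fin.last (2 * n)) = (0, 0) ∧
  (∀ i : Fin (2 * n),
    walkStep (2 * n) w i ∈ ({(1, 0), (-1, 0), (0, 1), (0, -1)} : Set (ℤ × ℤ))) ∧
  (∀ i j : Fin (2 * n), w i.castSucc = w j.castSucc → i = j) ∧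
  ThreeChoiceCond (2 * n) w

/-- The number of three-choice polygons of perimeter `2n`. -/
noncomputable def threeChoicePolygonCount (n : ℕ) : ℕ :=
  Nat.card {w : Fin (2 * n + 1) → ℤ × ℤ // IsThreeChoicePolygon n w}

/-- The set of lattice edges traversed by a path of `n` steps. -/
def pathEdges (n : ℕ) (p : Fin (n + 1) → ℤ × ℤ) : Set (Sym2 (ℤ × ℤ)) :=
  {e | ∃ i : Fin n, e = s(p i.castSucc, p i.succ)}

/-- The edge set of a three-choice polygon of perimeter `2n`. -/
def polygonEdges (n : ℕ) (w : Fin (2 * n + 1) → ℤ × ℤ) : Set (Sym2 (ℤ × ℤ)) :=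
  {e | ∃ i : Fin (2 * n), e = s(w i.castSucc, w i.succ)}

/-- Translation of a set of lattice edges by the vector `v`. -/
def translateEdges (v : ℤ × ℤ) (E : Set (Sym2 (ℤ × ℤ))) : Set (Sym2 (ℤ × ℤ)) :=
  (Sym2.map (· + v)) '' E

/-- `E` is the edge set of some staircase polygon. -/
def IsStaircaseEdgeSet (E : Set (Sym2 (ℤ × ℤ))) : Prop :=
  ∃ (n : ℕ) (p q : Fin (n + 1) → ℤ × ℤ),
    IsStaircasePair n p q ∧ E = pathEdges n p ∪ pathEdges n q

/-- `E` is a translate of the edge set of some staircase polygon. -/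
def IsStaircaseTranslate (E : Set (Sym2 (ℤ × ℤ))) : Prop :=
  ∃ (v : ℤ × ℤ) (F : Set (Sym2 (ℤ × ℤ))), IsStaircaseEdgeSet F ∧ E = translateEdges v F

/-- Two edge sets are translation-equivalent. -/
def TransEquiv (E F : Set (Sym2 (ℤ × ℤ))) : Prop :=
  ∃ v : ℤ × ℤ, F = translateEdges v E

/-- The number of imperfect staircase polygons of perimeter `2n`: translation-equivalence
classes of edge sets of three-choice polygons of perimeter `2n` that are not translates of
the edge set of any staircase polygon. -/
noncomputable def imperfectCount (n : ℕ) : ℕ :=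
  Nat.card {C : Set (Set (Sym2 (ℤ × ℤ))) //
    ∃ w : Fin (2 * n + 1) → ℤ × ℤ, IsThreeChoicePolygon n w ∧
      ¬ IsStaircaseTranslate (polygonEdges n w) ∧
      C = {F | TransEquiv (polygonEdges n w) F}}

/-- A self-avoiding path of `n` steps in the coordinates `d = x + y` and `x`, whose turns between
the direction classes `{north, east}` and `{south, west}` are all counterclockwise. -/
structure IsZigzag (n : ℕ) (d x : ℕ → ℤ) : Prop where
  step : ∀ t < n, (d (t + 1) = d t + 1 ∧ (x (t + 1) = x t ∨ x (t + 1) = x t + 1)) ∨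
    (d (t + 1) = d t - 1 ∧ (x (t + 1) = x t ∨ x (t + 1) = x t - 1))
  inj : ∀ s ≤ n, ∀ t ≤ n, d s = d t → x s = x t → s = t
  top : ∀ t, t + 1 < n → d (t + 1) = d t + 1 → d (t + 2) = d (t + 1) - 1 → x (t + 2) < x t
  bot : ∀ t, t + 1 < n → d (t + 1) = d t - 1 → d (t + 2) = d (t + 1) + 1 → x t < x (t + 2)

namespace IsZigzag

variable {n : ℕ} {d x : ℕ → ℤ}

theorem neg (h : IsZigzag n d x) : IsZigzag n (fun t => -d t) (fun t => -x t) where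
  step t ht := by have := h.step t ht; grind
  inj s hs t ht h1 h2 := h.inj s hs t ht (by simpa using h1) (by simpa using h2)
  top t ht h1 h2 := by have := h.bot t ht (by lia) (by lia); lia
  bot t ht h1 h2 := by have := h.top t ht (by lia) (by lia); lia

/-- If an ascending run is followed by a descending run which is not longer, then the ascending
run after that is strictly shorter. -/
theorem run_lt_of_up (h : IsZigzag n d x) {a b c e : ℕ} (hbc : b < c)
    (hen : e ≤ n) (h1 : ∀ t, a ≤ t → t < b → d (t + 1) = d t + 1)
    (h2 : ∀ t, b ≤ t → t < c → d (t + 1) = d t - 1)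
    (h3 : ∀ t, c ≤ t → t < e → d (t + 1) = d t + 1) (hL : c - b ≤ b - a) :
    e - c < c - b := by
  by_contra! hcon
  obtain ⟨L, rfl⟩ : ∃ L, c = b + L := ⟨c - b, by lia⟩
  have hA : ∀ j ≤ L, d (b - j) = d b - j := by
    intro j
    induction j with
    | zero => simp
    | succ j ih =>
      intro hj
      have h' := h1 (b - (j + 1)) (by lia) (by lia)
      rw [show b - (j + 1) + 1 = b - j by lia, ih (by lia)] at h'
      push_cast
      lia
  have hB : ∀ j ≤ L, d (b + j) = d b - j := by
    intro j
    induction j with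
    | zero => simp
    | succ j ih =>
      intro hj
      have h' := h2 (b + j) (by lia) (by lia)
      rw [ih (by lia)] at h'
      rw [← add_assoc, h']
      push_cast
      lia
  have hC : ∀ j ≤ L, d (b + L + j) = d b - L + j := by
    intro j
    induction j with
    | zero => simp [hB]
    | succ j ih =>
      intro hj
      have h' := h3 (b + L + j) (by lia) (by lia)
      rw [ih (by lia)] at h'
      rw [← add_assoc, h']
      push_cast
      lia
  have hBA : ∀ j, 1 ≤ j → j ≤ L → x (b + j) < x (b - j) := by
    intro j hj
    induction j, hj using Nat.le_induction with
    | base =>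
      intro _
      have h' := h.top (b - 1) (by lia) (h1 _ (by lia) (by lia))
      rw [show b - 1 + 2 = b + 1 by lia, show b - 1 + 1 = b by lia] at h'
      exact h' (h2 b (by lia) (by lia))
    | succ j hj ih =>
      intro hjL
      have ih := ih (by lia)
      have e1 := h.step (b + j) (by lia)
      have e2 := h.step (b - (j + 1)) (by lia)
      have u1 := h2 (b + j) (by lia) (by lia)
      have u2 := h1 (b - (j + 1)) (by lia) (by lia)
      rw [show b - (j + 1) + 1 = b - j by lia] at e2 u2
      have hne : x (b + (j + 1)) ≠ x (b - (j + 1)) := fun hx => by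
        have := h.inj _ (by lia) _ (by lia) ((hB _ hjL).trans (hA _ hjL).symm) hx
        lia
      rw [← add_assoc] at hne ⊢
      lia
  have hCA : ∀ i ≤ L, x (b + L + i) < x (b - (L - i)) := by
    intro i
    induction i with
    | zero => intro _; simpa using hBA L (by lia) le_rfl
    | succ i ih =>
      intro hi
      have ih := ih (by lia)
      have e1 := h.step (b + L + i) (by lia)
      have e2 := h.step (b - (L - i)) (by lia)
      have u1 := h3 (b + L + i) (by lia) (by lia)
      have u2 := h1 (b - (L - i)) (by lia) (by lia)
      rw [show b - (L - i) + 1 = b - (L - (i + 1)) by lia] at e2 u2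
      have hne : x (b + L + (i + 1)) ≠ x (b - (L - (i + 1))) := fun hx => by
        have := h.inj _ (by lia) _ (by lia)
          ((hC (i + 1) hi).trans (by rw [hA _ (by lia)]; lia)) hx
        lia
      rw [← add_assoc] at hne ⊢
      lia
  have hCB : ∀ i, 1 ≤ i → i ≤ L → x (b + (L - i)) < x (b + L + i) := by
    intro i hi
    induction i, hi using Nat.le_induction with
    | base =>
      intro _
      have h' := h.bot (b + (L - 1)) (by lia) (h2 _ (by lia) (by lia))
      rw [show b + (L - 1) + 2 = b + L + 1 by lia, show b + (L - 1) + 1 = b + L by lia] at h'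
      exact h' (h3 _ (by lia) (by lia))
    | succ i hi ih =>
      intro hiL
      have ih := ih (by lia)
      have e1 := h.step (b + L + i) (by lia)
      have e2 := h.step (b + (L - (i + 1))) (by lia)
      have u1 := h3 (b + L + i) (by lia) (by lia)
      have u2 := h2 (b + (L - (i + 1))) (by lia) (by lia)
      rw [show b + (L - (i + 1)) + 1 = b + (L - i) by lia] at e2 u2
      have hne : x (b + (L - (i + 1))) ≠ x (b + L + (i + 1)) := fun hx => by
        have := h.inj _ (by lia) _ (by lia)
          (((hC (i + 1) hiL).trans (by rw [hB _ (by lia)]; lia)).symm) hx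
        lia
      rw [← add_assoc] at hne ⊢
      lia
  have p1 := hCA L le_rfl
  have p2 := hCB L (by lia) le_rfl
  simp only [Nat.sub_self, Nat.sub_zero, add_zero] at p1 p2
  lia

/-- A time which is not interior to a run: an endpoint of the path or a change of direction
class. -/
def IsTurn (n : ℕ) (d : ℕ → ℤ) (t : ℕ) : Prop :=
  t = 0 ∨ n ≤ t ∨ ¬(d t = d (t - 1) + 1 ↔ d (t + 1) = d t + 1)

theorem infinite_isTurn (n : ℕ) (d : ℕ → ℤ) : {t | IsTurn n d t}.Infinite :=
  (Set.Ici_infinite n).mono fun _ ht => Or.inr (Or.inl ht)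

theorem not_isTurn_of_lt_nth {n : ℕ} {d : ℕ → ℤ} {i t : ℕ} (h1 : Nat.nth (IsTurn n d) i < t)
    (h2 : t < Nat.nth (IsTurn n d) (i + 1)) : ¬ IsTurn n d t := by
  classical
  intro ht
  rw [← Nat.nth_count ht] at h1 h2
  have hm := Nat.nth_strictMono (infinite_isTurn n d)
  have := hm.lt_iff_lt.1 h1
  have := hm.lt_iff_lt.1 h2
  lia

/-- The direction class is constant along a run. -/
theorem up_iff_of_mem_run (n : ℕ) (d : ℕ → ℤ) (i t : ℕ) (h1 : Nat.nth (IsTurn n d) i ≤ t) :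
    t < Nat.nth (IsTurn n d) (i + 1) →
    (d (t + 1) = d t + 1 ↔ d (Nat.nth (IsTurn n d) i + 1) = d (Nat.nth (IsTurn n d) i) + 1) := by
  induction t, h1 using Nat.le_induction with
  | base => simp
  | succ t ht ih =>
    intro h2
    have := not_isTurn_of_lt_nth (by lia : Nat.nth (IsTurn n d) i < t + 1) h2
    simp only [IsTurn, not_or, not_not, Nat.add_sub_cancel] at this
    rw [← this.2.2]
    exact ih (by lia)

/-- The length of the `i`-th run. -/
noncomputable def runLength (n : ℕ) (d : ℕ → ℤ) (i : ℕ) : ℕ :=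
  Nat.nth (IsTurn n d) (i + 1) - Nat.nth (IsTurn n d) i

theorem runLength_pos (n : ℕ) (d : ℕ → ℤ) (i : ℕ) : 0 < runLength n d i :=
  Nat.sub_pos_of_lt (Nat.nth_strictMono (infinite_isTurn n d) (Nat.lt_succ_self i))

open Classical in
theorem nth_le_of_le_count {n : ℕ} {d : ℕ → ℤ} {i : ℕ} (hi : i ≤ Nat.count (IsTurn n d) n) :
    Nat.nth (IsTurn n d) i ≤ n := by
  have hn : Nat.nth (IsTurn n d) (Nat.count (IsTurn n d) n) = n :=
    Nat.nth_count (Or.inr (Or.inl le_rfl))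
  exact ((Nat.nth_strictMono (infinite_isTurn n d)).monotone hi).trans hn.le

open Classical in
theorem nth_lt_of_lt_count {n : ℕ} {d : ℕ → ℤ} {i : ℕ} (hi : i < Nat.count (IsTurn n d) n) :
    Nat.nth (IsTurn n d) i < n := Nat.nth_lt_of_lt_count hi

open Classical in
theorem sum_runLength (n : ℕ) (d : ℕ → ℤ) :
    ∑ i ∈ Finset.range (Nat.count (IsTurn n d) n), runLength n d i ≤ n := by
  have h : ∀ k, ∑ i ∈ Finset.range k, runLength n d i ≤ Nat.nth (IsTurn n d) k := by
    intro k
    induction k with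
    | zero => simp
    | succ k ih =>
      rw [Finset.sum_range_succ]
      have := Nat.nth_strictMono (infinite_isTurn n d) (Nat.lt_succ_self k)
      unfold runLength
      simp only [runLength] at ih
      lia
  exact (h _).trans (nth_le_of_le_count le_rfl)

open Classical in
/-- At an interior turn the direction class changes. -/
theorem up_iff_not_up_succ {n : ℕ} {d : ℕ → ℤ} {i : ℕ} (hi : i + 1 < Nat.count (IsTurn n d) n) :
    (d (Nat.nth (IsTurn n d) i + 1) = d (Nat.nth (IsTurn n d) i) + 1 ↔
    ¬ d (Nat.nth (IsTurn n d) (i + 1) + 1) = d (Nat.nth (IsTurn n d) (i + 1)) + 1) := by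
  have hlt := Nat.nth_strictMono (infinite_isTurn n d) (Nat.lt_succ_self i)
  have hp : IsTurn n d (Nat.nth (IsTurn n d) (i + 1)) :=
    Nat.nth_mem_of_infinite (infinite_isTurn n d) _
  have hn := nth_lt_of_lt_count hi
  have h1 := up_iff_of_mem_run n d i (Nat.nth (IsTurn n d) (i + 1) - 1) (by lia) (by lia)
  rw [Nat.sub_add_cancel (by lia)] at h1
  rcases hp with h0 | h0 | h0
  · lia
  · lia
  · rw [← h1]; tauto

open Classical in
theorem runLength_lt (h : IsZigzag n d x) {i : ℕ} (hi : i + 2 < Nat.count (IsTurn n d) n)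
    (hle : runLength n d (i + 1) ≤ runLength n d i) :
    runLength n d (i + 2) < runLength n d (i + 1) := by
  have hm := Nat.nth_strictMono (infinite_isTurn n d)
  have hbc := hm (show i + 1 < i + 2 by lia)
  have hen := nth_le_of_le_count (show i + 3 ≤ Nat.count (IsTurn n d) n by lia)
  have hce := hm (show i + 2 < i + 3 by lia)
  have hab := hm (show i < i + 1 by lia)
  have t1 := up_iff_not_up_succ (show i + 1 < Nat.count (IsTurn n d) n by lia)
  have t2 := up_iff_not_up_succ hi
  have r1 := up_iff_of_mem_run n d i
  have r2 := up_iff_of_mem_run n d (i + 1)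
  have r3 := up_iff_of_mem_run n d (i + 2)
  by_cases hu : d (Nat.nth (IsTurn n d) i + 1) = d (Nat.nth (IsTurn n d) i) + 1
  · refine h.run_lt_of_up hbc hen ?_ ?_ ?_ hle
    · intro t ht ht'
      exact (r1 t ht ht').2 hu
    · intro t ht ht'
      have := r2 t ht ht'
      have := h.step t (by lia)
      tauto
    · intro t ht ht'
      have := r3 t ht ht'
      tauto
  · refine h.neg.run_lt_of_up hbc hen ?_ ?_ ?_ hle
    · intro t ht ht'
      have := r1 t ht ht'
      have := h.step t (by lia)
      lia
    · intro t ht ht'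
      have := r2 t ht ht'
      lia
    · intro t ht ht'
      have := r3 t ht ht'
      have := h.step t (by lia)
      lia

end IsZigzag

/-- A strictly increasing sequence of positive integers has quadratically growing sums. -/
theorem sq_le_two_mul_sum_of_lt {l : ℕ → ℕ} {m : ℕ} (h0 : ∀ i, 0 < l i)
    (hl : ∀ i, i + 1 < m → l i < l (i + 1)) : m ^ 2 ≤ 2 * ∑ i ∈ Finset.range m, l i := by
  have h1 : ∀ i, i < m → i + 1 ≤ l i := by
    intro i
    induction i with
    | zero => intro _; exact h0 0
    | succ i ih => intro hi; have := ih (by lia); have := hl i hi; lia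
  have h2 : ∑ i ∈ Finset.range m, (i + 1) ≤ ∑ i ∈ Finset.range m, l i :=
    Finset.sum_le_sum fun i hi => h1 i (Finset.mem_range.1 hi)
  have h3 := Finset.sum_range_id_mul_two (m + 1)
  rw [Finset.sum_range_succ'] at h3
  simp at h3
  simp [Finset.sum_add_distrib] at h3 h2
  nlinarith

/-- A sequence of positive integers that decreases strictly after its first weak descent has
quadratically growing sums. -/
theorem sq_le_eight_mul_sum {l : ℕ → ℕ} {k : ℕ} (h0 : ∀ i, 0 < l i)
    (hl : ∀ i, i + 2 < k → l (i + 1) ≤ l i → l (i + 2) < l (i + 1)) :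
    k ^ 2 ≤ 8 * (∑ i ∈ Finset.range k, l i + k) := by
  rcases Nat.eq_zero_or_pos k with rfl | hk
  · simp
  set m := k / 2 with hm
  have hmk : k ≤ 2 * m + 1 := by lia
  suffices hs : m ^ 2 ≤ 2 * ∑ i ∈ Finset.range k, l i by
    have : k ^ 2 ≤ (2 * m + 1) ^ 2 := Nat.pow_le_pow_left hmk 2
    have : 2 * m ≤ k := by lia
    lia
  by_cases hinc : ∀ i, i + 1 < m → l i < l (i + 1)
  · refine (sq_le_two_mul_sum_of_lt h0 hinc).trans ?_
    gcongr
    lia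
  · push Not at hinc
    obtain ⟨i, him, hi⟩ := hinc
    have hdec : ∀ j, i ≤ j → j + 1 < k → l (j + 1) ≤ l j := by
      intro j hj
      induction j, hj using Nat.le_induction with
      | base => intro _; exact hi
      | succ j hj ih => intro hjk; exact (hl j hjk (ih (by lia))).le
    have hrev := sq_le_two_mul_sum_of_lt (l := fun j => l (k - 1 - j)) (m := m)
      (fun j => h0 _) (fun j hj => by
        have := hl (k - 1 - j - 2) (by lia) (hdec _ (by lia) (by lia))
        rw [show k - 1 - j - 2 + 2 = k - 1 - j by lia,
          show k - 1 - j - 2 + 1 = k - 1 - (j + 1) by lia] at this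
        exact this)
    refine hrev.trans ?_
    rw [← Finset.sum_range_reflect l k]
    gcongr
    lia

open Classical in
/-- A zigzag path has `O(√n)` turns. -/
theorem IsZigzag.sq_count_le {n : ℕ} {d x : ℕ → ℤ} (h : IsZigzag n d x) :
    (Nat.count (IsZigzag.IsTurn n d) n) ^ 2 ≤
      8 * (n + Nat.count (IsZigzag.IsTurn n d) n) := by
  refine (sq_le_eight_mul_sum (IsZigzag.runLength_pos n d) fun i hi => h.runLength_lt hi).trans ?_
  have := IsZigzag.sum_runLength n d
  gcongr

/-- The direction class at time `0`, the turns, and the steps keeping `x` fixed determine a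
zigzag path. -/
theorem IsZigzag.eq_of_code_eq {n : ℕ} {d x d' x' : ℕ → ℤ} (h : IsZigzag n d x)
    (h' : IsZigzag n d' x') (hd : d 0 = d' 0) (hx : x 0 = x' 0)
    (hup : d 1 = d 0 + 1 ↔ d' 1 = d' 0 + 1)
    (hturn : ∀ t < n, IsZigzag.IsTurn n d t ↔ IsZigzag.IsTurn n d' t)
    (hfix : ∀ t < n, x (t + 1) = x t ↔ x' (t + 1) = x' t) :
    ∀ t ≤ n, d t = d' t ∧ x t = x' t := by
  have hcls : ∀ t < n, (d (t + 1) = d t + 1 ↔ d' (t + 1) = d' t + 1) := by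
    intro t
    induction t with
    | zero => intro _; exact hup
    | succ t ih =>
      intro ht
      have ih := ih (by lia)
      have := hturn (t + 1) ht
      simp only [IsZigzag.IsTurn, Nat.add_sub_cancel] at this
      have h1 : ¬ n ≤ t + 1 := by lia
      have h2 : ¬ t + 1 = 0 := by lia
      tauto
  intro t
  induction t with
  | zero => intro _; exact ⟨hd, hx⟩
  | succ t ih =>
    intro ht
    have ih := ih (by lia)
    have := hcls t ht
    have := hfix t ht
    have := h.step t ht
    have := h'.step t ht
    lia

/-- The vertices of a walk indexed by natural numbers, constant after the end of the walk. -/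
def walkVertex (n : ℕ) (w : Fin (n + 1) → ℤ × ℤ) (t : ℕ) : ℤ × ℤ :=
  w ⟨min t n, by lia⟩

theorem walkVertex_succ_sub {n : ℕ} (w : Fin (n + 1) → ℤ × ℤ) {t : ℕ} (ht : t < n) :
    walkVertex n w (t + 1) - walkVertex n w t = walkStep n w ⟨t, ht⟩ := by
  simp [walkVertex, walkStep, min_eq_left ht.le, min_eq_left (Nat.succ_le_of_lt ht)]

theorem IsThreeChoiceWalk.isZigzag {n : ℕ} {w : Fin (n + 1) → ℤ × ℤ}
    (h : IsThreeChoiceWalk n w) :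
    IsZigzag n (fun t => (walkVertex n w t).1 + (walkVertex n w t).2)
      (fun t => (walkVertex n w t).1) := by
  obtain ⟨-, hs, hinj, hc⟩ := h
  have hstep : ∀ t (ht : t < n), walkStep n w ⟨t, ht⟩ =
      ((walkVertex n w (t + 1)).1 - (walkVertex n w t).1,
        (walkVertex n w (t + 1)).2 - (walkVertex n w t).2) := fun t ht => by
    rw [← walkVertex_succ_sub]; rfl
  have hs' : ∀ t (ht : t < n), _ := fun t ht => hs ⟨t, ht⟩
  have hc' : ∀ t (ht : t + 1 < n), _ := fun t ht =>
    hc ⟨t, by lia⟩ ⟨t + 1, ht⟩ rfl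
  simp only [hstep, Set.mem_insert_iff, Set.mem_singleton_iff, Prod.mk.injEq] at hs' hc'
  have hinj' : ∀ s ≤ n, ∀ t ≤ n, (walkVertex n w s).1 = (walkVertex n w t).1 →
      (walkVertex n w s).2 = (walkVertex n w t).2 → s = t := fun s hs t ht h1 h2 => by
    have h3 : walkVertex n w s = walkVertex n w t := Prod.ext h1 h2
    have h4 := hinj h3
    simp only [Fin.mk.injEq] at h4
    lia
  refine ⟨fun t ht => ?_, fun s hs t ht h1 h2 => ?_, fun t ht h1 h2 => ?_, fun t ht h1 h2 => ?_⟩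
  · have := hs' t ht
    lia
  · exact hinj' s hs t ht h2 (by lia)
  · have := hs' t (by lia)
    have := hs' (t + 1) ht
    have := hc' t ht
    have := hinj' t (by lia) (t + 2) (by lia)
    simp only [add_assoc, Nat.reduceAdd] at *
    lia
  · have := hs' t (by lia)
    have := hs' (t + 1) ht
    have := hc' t ht
    have := hinj' t (by lia) (t + 2) (by lia)
    simp only [add_assoc, Nat.reduceAdd] at *
    lia

theorem sum_choose_le_succ_pow (n k : ℕ) :
    ∑ j ∈ Finset.range (k + 1), n.choose j ≤ (n + 1) ^ k := by
  rw [add_pow]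
  refine Finset.sum_le_sum fun j hj => ?_
  have h1 : 0 < k.choose j := Nat.choose_pos (by simpa [Nat.lt_succ_iff] using hj)
  calc n.choose j ≤ n ^ j := Nat.choose_le_pow n j
    _ ≤ n ^ j * 1 ^ (k - j) * k.choose j := by
      simpa using Nat.le_mul_of_pos_right _ h1

theorem card_powerset_range_filter_card_le (n k : ℕ) :
    ((Finset.range n).powerset.filter (fun s => s.card ≤ k)).card ≤ (n + 1) ^ k := by
  have h : (Finset.range n).powerset.filter (fun s => s.card ≤ k) =
      (Finset.range (k + 1)).biUnion fun j => (Finset.range n).powersetCard j := by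
    ext s
    simp [Finset.mem_powersetCard, and_comm]
  rw [h]
  refine Finset.card_biUnion_le.trans ?_
  simpa using sum_choose_le_succ_pow n k

/-- The codes of three-choice walks: the direction class at time `0`, the set of turns, and the set
of vertical steps. -/
def walkCodes (n : ℕ) : Finset (Bool × Finset ℕ × Finset ℕ) :=
  Finset.univ ×ˢ (Finset.range n).powerset.filter (fun s => s.card ≤ 4 * (n.sqrt + 1)) ×ˢ
    (Finset.range n).powerset

theorem card_walkCodes_le (n : ℕ) :
    (walkCodes n).card ≤ 2 * ((n + 1) ^ (4 * (n.sqrt + 1)) * 2 ^ n) := by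
  have := card_powerset_range_filter_card_le n (4 * (n.sqrt + 1))
  simp only [walkCodes, Finset.card_product, Finset.card_univ, Fintype.card_bool,
    Finset.card_powerset, Finset.card_range]
  gcongr

open Classical in
theorem exists_injective_walkCodes (n : ℕ) :
    ∃ f : {w : Fin (n + 1) → ℤ × ℤ // IsThreeChoiceWalk n w} → walkCodes n,
      Function.Injective f := by
  let x : (Fin (n + 1) → ℤ × ℤ) → ℕ → ℤ := fun w t => (walkVertex n w t).1
  let d : (Fin (n + 1) → ℤ × ℤ) → ℕ → ℤ := fun w t => (walkVertex n w t).1 + (walkVertex n w t).2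
  refine ⟨fun w => ⟨(decide (d w 1 = d w 0 + 1),
    (Finset.range n).filter (IsZigzag.IsTurn n (d w)),
    (Finset.range n).filter (fun t => x w (t + 1) = x w t)), ?_⟩, ?_⟩
  · simp only [walkCodes, Finset.mem_product, Finset.mem_univ, Finset.mem_filter,
      Finset.mem_powerset, Finset.filter_subset, true_and, and_true]
    have h1 := w.2.isZigzag.sq_count_le
    have h2 : Nat.count (IsZigzag.IsTurn n (d w)) n ≤ n := Nat.count_le _
    change (Nat.count (IsZigzag.IsTurn n (d w)) n) ^ 2 ≤
      8 * (n + Nat.count (IsZigzag.IsTurn n (d w)) n) at h1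
    rw [← Nat.count_eq_card_filter_range]
    have h3 : n < (n.sqrt + 1) ^ 2 := Nat.lt_succ_sqrt' n
    refine le_of_lt (lt_of_pow_lt_pow_left₀ 2 (by lia) ?_)
    rw [mul_pow]
    lia
  · intro w w' hww
    simp only [Subtype.mk.injEq, Prod.mk.injEq, decide_eq_decide, Finset.filter_inj',
      Finset.mem_range] at hww
    obtain ⟨hup, hturn, hfix⟩ := hww
    have h0 : walkVertex n w 0 = walkVertex n w' 0 := by
      have h1 := w.2.1
      have h2 := w'.2.1
      simp only [walkVertex, Nat.zero_min]
      exact h1.trans h2.symm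
    have key := w.2.isZigzag.eq_of_code_eq w'.2.isZigzag (by simp only [h0]) (by simp only [h0])
      hup (fun t ht => hturn ht) (fun t ht => hfix ht)
    refine Subtype.ext (funext fun i => ?_)
    have hi := key i (Nat.lt_succ_iff.1 i.2)
    have : ∀ v : Fin (n + 1) → ℤ × ℤ, walkVertex n v i = v i := fun v => by
      simp [walkVertex, min_eq_left (Nat.lt_succ_iff.1 i.2)]
    simp only [this] at hi
    exact Prod.ext hi.2 (by lia)

instance finite_threeChoiceWalk (n : ℕ) :
    Finite {w : Fin (n + 1) → ℤ × ℤ // IsThreeChoiceWalk n w} := by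
  obtain ⟨f, hf⟩ := exists_injective_walkCodes n
  exact Finite.of_injective f hf

theorem threeChoiceWalkCount_le (n : ℕ) :
    threeChoiceWalkCount n ≤ 2 * ((n + 1) ^ (4 * (n.sqrt + 1)) * 2 ^ n) := by
  obtain ⟨f, hf⟩ := exists_injective_walkCodes n
  refine (Nat.card_le_card_of_injective f hf).trans ?_
  simpa using card_walkCodes_le n

/-- The walk that steps east at the times in `s` and north otherwise. -/
def directedWalk (n : ℕ) (s : Finset ℕ) (i : Fin (n + 1)) : ℤ × ℤ :=
  (∑ t ∈ Finset.range i, if t ∈ s then 1 else 0, ∑ t ∈ Finset.range i, if t ∈ s then 0 else 1)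

theorem walkStep_directedWalk (n : ℕ) (s : Finset ℕ) (i : Fin n) :
    walkStep n (directedWalk n s) i = if (i : ℕ) ∈ s then (1, 0) else (0, 1) := by
  simp only [walkStep, directedWalk, Fin.val_succ, Fin.val_castSucc, Finset.sum_range_succ]
  split_ifs <;> simp

theorem directedWalk_fst_add_snd (n : ℕ) (s : Finset ℕ) (i : Fin (n + 1)) :
    (directedWalk n s i).1 + (directedWalk n s i).2 = (i : ℕ) := by
  simp only [directedWalk, ← Finset.sum_add_distrib]
  have : ∀ t, ((if t ∈ s then 1 else 0) + (if t ∈ s then 0 else 1) : ℤ) = 1 := fun t => by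
    split_ifs <;> simp
  simp only [this]
  simp

theorem isThreeChoiceWalk_directedWalk (n : ℕ) (s : Finset ℕ) :
    IsThreeChoiceWalk n (directedWalk n s) := by
  refine ⟨by simp [directedWalk], fun i => ?_, fun i j hij => ?_, fun i j _ => ?_⟩
  · rw [walkStep_directedWalk]
    split_ifs <;> simp
  · have h1 := directedWalk_fst_add_snd n s i
    have h2 := directedWalk_fst_add_snd n s j
    rw [hij] at h1
    exact Fin.ext (by lia)
  · simp only [walkStep_directedWalk]
    split_ifs <;> simp

theorem two_pow_le_threeChoiceWalkCount (n : ℕ) : 2 ^ n ≤ threeChoiceWalkCount n := by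
  let f : (Finset.range n).powerset → {w : Fin (n + 1) → ℤ × ℤ // IsThreeChoiceWalk n w} :=
    fun s => ⟨directedWalk n s, isThreeChoiceWalk_directedWalk n s⟩
  have hf : Function.Injective f := by
    intro s s' hss
    have h1 : directedWalk n s = directedWalk n s' := congrArg Subtype.val hss
    refine Subtype.ext (Finset.ext fun t => ?_)
    by_cases ht : t < n
    · have h2 := walkStep_directedWalk n s ⟨t, ht⟩
      rw [h1, walkStep_directedWalk] at h2
      by_cases h3 : t ∈ s.1 <;> by_cases h4 : t ∈ s'.1 <;> simp_all
    · have h3 := Finset.mem_powerset.1 s.2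
      have h4 := Finset.mem_powerset.1 s'.2
      have h5 : t ∉ Finset.range n := by simpa using ht
      exact iff_of_false (fun h => h5 (h3 h)) (fun h => h5 (h4 h))
  have h := Nat.card_le_card_of_injective f hf
  rwa [Nat.card_eq_fintype_card, Fintype.card_coe, Finset.card_powerset, Finset.card_range] at h

theorem tendsto_log_succ_mul_sqrt_div :
    Filter.Tendsto (fun n : ℕ => (Real.log 2 + 4 * ((n.sqrt : ℝ) + 1) * Real.log (n + 1)) / n)
      Filter.atTop (nhds 0) := by
  have h1 : Filter.Tendsto (fun n : ℕ => Real.log n / (n : ℝ) ^ (1 / 2 : ℝ))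
      Filter.atTop (nhds 0) :=
    ((isLittleO_log_rpow_atTop (by norm_num : (0 : ℝ) < 1 / 2)).tendsto_div_nhds_zero).comp
      tendsto_natCast_atTop_atTop
  have h2 : Filter.Tendsto (fun n : ℕ => Real.log 2 / (n : ℝ) +
      8 * (Real.log 2 / (n : ℝ) ^ (1 / 2 : ℝ) + Real.log n / (n : ℝ) ^ (1 / 2 : ℝ)))
      Filter.atTop (nhds 0) := by
    have h3 := tendsto_const_div_atTop_nhds_zero_nat (Real.log 2)
    have h4 : Filter.Tendsto (fun n : ℕ => Real.log 2 / (n : ℝ) ^ (1 / 2 : ℝ))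
        Filter.atTop (nhds 0) :=
      ((tendsto_rpow_atTop (by norm_num : (0 : ℝ) < 1 / 2)).comp
        tendsto_natCast_atTop_atTop).const_div_atTop _
    simpa using h3.add ((h4.add h1).const_mul 8)
  refine squeeze_zero' (Filter.Eventually.of_forall fun n => ?_) ?_ h2
  · have : 0 ≤ Real.log ((n : ℝ) + 1) := Real.log_nonneg (by simp)
    have := Real.log_nonneg (by norm_num : (1 : ℝ) ≤ 2)
    positivity
  · filter_upwards [Filter.eventually_ge_atTop 1] with n hn
    have hn' : (1 : ℝ) ≤ n := by exact_mod_cast hn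
    rw [← Real.sqrt_eq_rpow, add_div]
    have hs : (n.sqrt : ℝ) ≤ √n := Real.nat_sqrt_le_real_sqrt
    have hs1 : 1 ≤ √(n : ℝ) := Real.one_le_sqrt.2 hn'
    have hl : Real.log (n + 1) ≤ Real.log 2 + Real.log n := by
      rw [← Real.log_mul (by norm_num) (by positivity)]
      exact Real.log_le_log (by linarith) (by linarith)
    have hl0 : 0 ≤ Real.log ((n : ℝ) + 1) := Real.log_nonneg (by simp)
    have hsq : √(n : ℝ) * √n = n := Real.mul_self_sqrt (by linarith)
    gcongr
    rw [div_le_iff₀ (by linarith), ← add_div]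
    calc 4 * ((n.sqrt : ℝ) + 1) * Real.log (n + 1)
        ≤ 4 * (2 * √n) * (Real.log 2 + Real.log n) := by
          gcongr
          linarith
      _ = 8 * ((Real.log 2 + Real.log n) / √n) * (√n * √n) := by
          field_simp
          ring
      _ = _ := by rw [hsq]

/-- The growth constant of three-choice walks is exactly `2`:
`lim_{n→∞} w_n^{1/n} = 2`. -/
theorem threeChoiceWalk_growth_constant :
    Filter.Tendsto (fun n : ℕ => (threeChoiceWalkCount n : ℝ) ^ (1 / (n : ℝ)))
      Filter.atTop (nhds 2) := by
  have hup : Filter.Tendsto (fun n : ℕ => 2 * Real.exp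
      ((Real.log 2 + 4 * ((n.sqrt : ℝ) + 1) * Real.log (n + 1)) / n))
      Filter.atTop (nhds 2) := by
    simpa using ((Real.continuous_exp.tendsto 0).comp tendsto_log_succ_mul_sqrt_div).const_mul 2
  have hpow : ∀ n : ℕ, 1 ≤ n → ((2 : ℝ) ^ n) ^ (1 / (n : ℝ)) = 2 := fun n hn => by
    rw [one_div, Real.pow_rpow_inv_natCast (by norm_num) (by lia)]
  refine tendsto_of_tendsto_of_tendsto_of_le_of_le' tendsto_const_nhds hup ?_ ?_
  · filter_upwards [Filter.eventually_ge_atTop 1] with n hn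
    rw [← hpow n hn]
    have := two_pow_le_threeChoiceWalkCount n
    gcongr
    exact_mod_cast this
  · filter_upwards [Filter.eventually_ge_atTop 1] with n hn
    have h1 : (threeChoiceWalkCount n : ℝ) ≤
        2 ^ n * (2 * ((n : ℝ) + 1) ^ (4 * (n.sqrt + 1))) := by
      have h2 : (threeChoiceWalkCount n : ℝ) ≤
          ((2 * ((n + 1) ^ (4 * (n.sqrt + 1)) * 2 ^ n) : ℕ) : ℝ) := by
        exact_mod_cast threeChoiceWalkCount_le n
      push_cast at h2
      linarith
    calc (threeChoiceWalkCount n : ℝ) ^ (1 / (n : ℝ))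
        ≤ (2 ^ n * (2 * ((n : ℝ) + 1) ^ (4 * (n.sqrt + 1)))) ^ (1 / (n : ℝ)) := by gcongr
      _ = 2 * Real.exp
          ((Real.log 2 + 4 * ((n.sqrt : ℝ) + 1) * Real.log (n + 1)) / n) := by
          rw [Real.mul_rpow (by positivity) (by positivity), hpow n hn,
            Real.rpow_def_of_pos (by positivity), Real.log_mul (by norm_num) (by positivity),
            Real.log_pow]
          push_cast
          rw [mul_one_div]
end

section
/- The sequences t_n, p_n and c_n all grow like 4^n: lim_{n→∞} t_n^{1/n} = 4, lim_{n→∞} p_n^{1/n} = 4, and lim_{n→∞} c_n^{1/n} = 4. -/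
open Filter Topology in
/-- A sequence which differs from `4 ^ n` by a factor whose `n`-th root tends to `1` has
`n`-th root tending to `4`. -/
theorem tendsto_root_four {a E : ℕ → ℝ} (hE : ∀ n, 0 < E n)
    (hE1 : Tendsto (fun n : ℕ => E n ^ (1 / (n : ℝ))) atTop (𝓝 1))
    (hlow : ∀ᶠ n in atTop, (4 : ℝ) ^ n / E n ≤ a n)
    (hup : ∀ᶠ n in atTop, a n ≤ (4 : ℝ) ^ n * E n) :
    Tendsto (fun n : ℕ => a n ^ (1 / (n : ℝ))) atTop (𝓝 4) := by
  have hroot : ∀ n : ℕ, 1 ≤ n → ((4 : ℝ) ^ n) ^ (1 / (n : ℝ)) = 4 := fun n hn => by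
    rw [one_div]
    exact Real.pow_rpow_inv_natCast (by norm_num) (by omega)
  have h1 : Tendsto (fun n : ℕ => 4 / E n ^ (1 / (n : ℝ))) atTop (𝓝 4) := by
    have := (tendsto_const_nhds (x := (4 : ℝ))).div hE1 one_ne_zero
    rw [div_one] at this
    exact this
  have h2 : Tendsto (fun n : ℕ => 4 * E n ^ (1 / (n : ℝ))) atTop (𝓝 4) := by
    simpa using (tendsto_const_nhds (x := (4 : ℝ))).mul hE1
  refine tendsto_of_tendsto_of_tendsto_of_le_of_le' h1 h2 ?_ ?_
  · filter_upwards [hlow, eventually_ge_atTop 1] with n hn hn1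
    calc 4 / E n ^ (1 / (n : ℝ)) = (4 ^ n / E n) ^ (1 / (n : ℝ)) := by
          rw [Real.div_rpow (by positivity) (hE n).le, hroot n hn1]
      _ ≤ _ := Real.rpow_le_rpow (div_nonneg (by positivity) (hE n).le) hn (by positivity)
  · filter_upwards [hlow, hup, eventually_ge_atTop 1] with n hn hn' hn1
    calc a n ^ (1 / (n : ℝ)) ≤ (4 ^ n * E n) ^ (1 / (n : ℝ)) :=
          Real.rpow_le_rpow ((div_nonneg (by positivity) (hE n).le).trans hn) hn' (by positivity)
      _ = _ := by rw [Real.mul_rpow (by positivity) (hE n).le, hroot n hn1]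

/-- Upper bound for the number of direction reversals of a three-choice polygon of
perimeter `2n`. -/
def reversalBound (n : ℕ) : ℕ := 2 * Nat.sqrt (4 * n) + 6

/-- The subexponential factor by which the counting sequences may differ from `4 ^ n`. -/
def subexpFactor (n : ℕ) : ℕ := (2 * n + 1) ^ (2 * reversalBound n)

theorem subexpFactor_pos (n : ℕ) : 0 < subexpFactor n := by
  unfold subexpFactor; positivity

open Filter Topology in
theorem tendsto_subexpFactor_root :
    Tendsto (fun n : ℕ => (subexpFactor n : ℝ) ^ (1 / (n : ℝ))) atTop (𝓝 1) := by
  have hexp : ∀ n : ℕ, (subexpFactor n : ℝ) ^ (1 / (n : ℝ)) =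
      Real.exp (Real.log (2 * n + 1) * (2 * reversalBound n) / n) := fun n => by
    have h : (0 : ℝ) < 2 * n + 1 := by positivity
    rw [Real.rpow_def_of_pos (by exact_mod_cast subexpFactor_pos n)]
    congr 1
    simp only [subexpFactor]
    push_cast
    rw [Real.log_pow]
    push_cast
    ring
  simp_rw [hexp]
  rw [show 𝓝 (1 : ℝ) = 𝓝 (Real.exp 0) by rw [Real.exp_zero]]
  refine (Real.continuous_exp.tendsto 0).comp ?_
  have hlim : Tendsto (fun n : ℕ => (240 : ℝ) * (n : ℝ) ^ (-(1 / 4) : ℝ)) atTop (𝓝 0) := by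
    have := ((tendsto_rpow_neg_atTop (y := 1 / 4) (by norm_num)).comp
      tendsto_natCast_atTop_atTop).const_mul (240 : ℝ)
    simpa using this
  refine squeeze_zero' ?_ ?_ hlim
  · refine Eventually.of_forall fun n => ?_
    have : 0 ≤ Real.log (2 * (n : ℝ) + 1) :=
      Real.log_nonneg (by linarith [Nat.cast_nonneg (α := ℝ) n])
    exact div_nonneg (mul_nonneg this (by positivity)) (by positivity)
  · filter_upwards [eventually_ge_atTop 1] with n hn
    have hn' : (1 : ℝ) ≤ n := by exact_mod_cast hn
    have hn0 : (0 : ℝ) < n := by linarith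
    have hlog : Real.log (2 * (n : ℝ) + 1) ≤ 12 * (n : ℝ) ^ (1 / 4 : ℝ) := by
      calc Real.log (2 * (n : ℝ) + 1) ≤ Real.log (3 * n) :=
            Real.log_le_log (by positivity) (by linarith)
        _ ≤ (3 * n : ℝ) ^ (1 / 4 : ℝ) / (1 / 4) :=
            Real.log_le_rpow_div (by positivity) (by norm_num)
        _ = 4 * ((3 : ℝ) ^ (1 / 4 : ℝ) * (n : ℝ) ^ (1 / 4 : ℝ)) := by
            rw [Real.mul_rpow (by norm_num) hn0.le]; ring
        _ ≤ 4 * (3 * (n : ℝ) ^ (1 / 4 : ℝ)) := by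
            gcongr
            exact Real.rpow_le_self_of_one_le (by norm_num) (by norm_num)
        _ = _ := by ring
    have hsqrt : (1 : ℝ) ≤ (n : ℝ) ^ (1 / 2 : ℝ) := Real.one_le_rpow hn' (by norm_num)
    have hrev : (2 * reversalBound n : ℝ) ≤ 20 * (n : ℝ) ^ (1 / 2 : ℝ) := by
      have h : (Nat.sqrt (4 * n) : ℝ) ≤ 2 * (n : ℝ) ^ (1 / 2 : ℝ) := by
        have := Real.nat_sqrt_le_real_sqrt (a := 4 * n)
        rw [← Real.sqrt_eq_rpow]
        refine this.trans_eq ?_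
        push_cast
        rw [Real.sqrt_mul (by norm_num), show (4 : ℝ) = 2 ^ 2 by norm_num,
          Real.sqrt_sq (by norm_num)]
      simp only [reversalBound]
      push_cast
      linarith
    rw [div_le_iff₀ hn0]
    calc Real.log (2 * n + 1) * (2 * reversalBound n)
        ≤ (12 * (n : ℝ) ^ (1 / 4 : ℝ)) * (20 * (n : ℝ) ^ (1 / 2 : ℝ)) := by gcongr
      _ = 240 * ((n : ℝ) ^ (1 / 4 : ℝ) * (n : ℝ) ^ (1 / 2 : ℝ)) := by ring
      _ = 240 * ((n : ℝ) ^ (-(1 / 4) : ℝ) * (n : ℝ) ^ (1 : ℝ)) := by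
          rw [← Real.rpow_add hn0, ← Real.rpow_add hn0]; norm_num
      _ = 240 * (n : ℝ) ^ (-(1 / 4) : ℝ) * n := by rw [Real.rpow_one]; ring

/-- A sequence of gaps in which any non-increase is followed by strict decrease forever has at
most about `2 √(2N)` terms if the gaps sum to at most `N`. -/
theorem le_of_unimodal_gaps {N k : ℕ} {J : ℕ → ℕ} (hmono : ∀ i < k, J i < J (i + 1))
    (hN : J k ≤ N)
    (hgap : ∀ i, i + 2 < k → J (i + 2) - J (i + 1) ≤ J (i + 1) - J i →
      J (i + 3) - J (i + 2) < J (i + 2) - J (i + 1)) :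
    k ≤ 2 * Nat.sqrt (2 * N) + 4 := by
  have hsq : ∀ r, r * r ≤ 2 * N → r ≤ Nat.sqrt (2 * N) := fun r hr => Nat.le_sqrt.2 hr
  have hle : ∀ d i, i + d ≤ k → J i ≤ J (i + d) := by
    intro d
    induction d with
    | zero => intros; exact le_rfl
    | succ d ih =>
      intro i hi
      have h1 := ih i (by omega)
      have h2 := hmono (i + d) (by omega)
      rw [← add_assoc]
      omega
  by_cases hk : k ≤ 4
  · omega
  by_cases hasc : ∀ i < k / 2, J (i + 1) - J i < J (i + 2) - J (i + 1)
  · have hg : ∀ i ≤ k / 2, i + 1 ≤ J (i + 1) - J i := by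
      intro i
      induction i with
      | zero => intro _; have := hmono 0 (by omega); omega
      | succ i ih =>
        intro hi
        have h1 := ih (by omega)
        have h2 := hasc i (by omega)
        rw [show i + 1 + 1 = i + 2 from rfl]
        omega
    have hJ : ∀ i ≤ k / 2, i * i ≤ 2 * J i := by
      intro i
      induction i with
      | zero => intro _; omega
      | succ i ih =>
        intro hi
        have h1 := ih (by omega)
        have h2 := hg i (by omega)
        have h3 := hmono i (by omega)
        nlinarith [Nat.sub_add_cancel h3.le]
    have h1 := hJ (k / 2) le_rfl
    have h2 := hle (k - k / 2) (k / 2) (by omega)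
    rw [Nat.add_sub_cancel' (by omega)] at h2
    have := hsq (k / 2) (by omega)
    omega
  · push Not at hasc
    obtain ⟨i₀, hi₀, hle₀⟩ := hasc
    have hdec : ∀ d, i₀ + d + 2 < k →
        J (i₀ + d + 3) - J (i₀ + d + 2) < J (i₀ + d + 2) - J (i₀ + d + 1) := by
      intro d
      induction d with
      | zero => intro h; exact hgap i₀ h hle₀
      | succ d ih =>
        intro h
        exact hgap (i₀ + (d + 1)) h (ih (by omega)).le
    have hg : ∀ r, r + (i₀ + 2) ≤ k → r + 1 ≤ J (k - r) - J (k - r - 1) := by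
      intro r
      induction r with
      | zero =>
        intro h
        have := hmono (k - 1) (by omega)
        rw [Nat.sub_add_cancel (by omega)] at this
        rw [Nat.sub_zero]
        omega
      | succ r ih =>
        intro h
        have h1 := ih (by omega)
        have h2 := hdec (k - r - 3 - i₀) (by omega)
        rw [show i₀ + (k - r - 3 - i₀) + 3 = k - r by omega,
          show i₀ + (k - r - 3 - i₀) + 2 = k - r - 1 by omega,
          show i₀ + (k - r - 3 - i₀) + 1 = k - r - 2 by omega] at h2
        rw [show k - (r + 1) - 1 = k - r - 2 by omega, show k - (r + 1) = k - r - 1 by omega]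
        omega
    have hJ : ∀ r, r + (i₀ + 1) ≤ k → r * r + 2 * J (k - r) ≤ 2 * J k := by
      intro r
      induction r with
      | zero => intro _; simp
      | succ r ih =>
        intro h
        have h1 := ih (by omega)
        have h2 := hg r (by omega)
        have h3 := hmono (k - r - 1) (by omega)
        rw [show k - r - 1 + 1 = k - r by omega] at h3
        rw [show k - (r + 1) = k - r - 1 by omega]
        nlinarith [Nat.sub_add_cancel h3.le]
    have h1 := hJ (k - (i₀ + 1)) (by omega)
    have := hsq (k - (i₀ + 1)) (by omega)
    omega

/-- A finite set of naturals below `N` whose gaps between consecutive elements are unimodal has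
at most about `2 √(2N)` elements. -/
theorem card_le_of_unimodal_gaps {N : ℕ} {S : Finset ℕ} (hS : ∀ i ∈ S, i < N)
    (hgap : ∀ a ∈ S, ∀ b ∈ S, ∀ c ∈ S, ∀ d ∈ S, a < b → b < c → c < d →
      (∀ i, a < i → i < d → i ∈ S → i = b ∨ i = c) → c - b ≤ b - a → d - c < c - b) :
    S.card ≤ 2 * Nat.sqrt (2 * N) + 5 := by
  have hf : (Set.ofPred (· ∈ S)).Finite := S.finite_toSet
  have hcard : hf.toFinset.card = S.card := by
    congr 1
    ext i
    simp
  rcases Nat.eq_zero_or_pos S.card with h0 | h0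
  · omega
  set J := Nat.nth (· ∈ S) with hJ
  have hmem : ∀ i < S.card, J i ∈ S := fun i hi =>
    Nat.nth_mem_of_lt_card hf (by rw [hcard]; exact hi)
  have hlt : ∀ i, i + 1 < S.card → J i < J (i + 1) := fun i hi =>
    Nat.nth_lt_nth_of_lt_card hf (Nat.lt_succ_self i) (by rw [hcard]; exact hi)
  have hnext : ∀ i j, j ∈ S → j < J (i + 1) → j ≤ J i := fun i j hj hij =>
    Nat.le_nth_of_lt_nth_succ hij hj
  have := le_of_unimodal_gaps (N := N) (k := S.card - 1) (J := J)
    (fun i hi => hlt i (by omega)) (hS _ (hmem _ (by omega))).le (by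
      intro i hi hle
      refine hgap (J i) (hmem _ (by omega)) (J (i + 1)) (hmem _ (by omega)) (J (i + 2))
        (hmem _ (by omega)) (J (i + 3)) (hmem _ (by omega)) (hlt _ (by omega)) (hlt _ (by omega))
        (hlt _ (by omega)) ?_ hle
      intro j h1 h2 hj
      have h3 := hnext (i + 2) j hj h2
      have h4 := hnext (i + 1) j hj
      have h5 := hnext i j hj
      rw [show i + 1 + 1 = i + 2 from rfl] at h4
      omega)
  omega

/-- Discrete intermediate value theorem: a nonvanishing integer sequence with increments in
`{-1, 0, 1}` which is negative somewhere is negative everywhere. -/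
theorem neg_of_ne_zero_of_step {D : ℕ → ℤ} {a b t₀ : ℕ} (h0 : ∀ t, a ≤ t → t ≤ b → D t ≠ 0)
    (hstep : ∀ t, a ≤ t → t < b → D (t + 1) ≤ D t + 1 ∧ D t ≤ D (t + 1) + 1)
    (ha : a ≤ t₀) (hb : t₀ ≤ b) (hneg : D t₀ < 0) : ∀ t, a ≤ t → t ≤ b → D t < 0 := by
  have hiff : ∀ r, a + r ≤ b → (D (a + r) < 0 ↔ D a < 0) := by
    intro r
    induction r with
    | zero => intro _; rfl
    | succ r ih =>
      intro hr
      rw [← ih (by omega), ← add_assoc]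
      have h1 := h0 (a + r) (by omega) (by omega)
      have h2 := h0 (a + r + 1) (by omega) (by omega)
      have h3 := hstep (a + r) (by omega) (by omega)
      omega
  intro t h1 h2
  have h3 := (hiff (t₀ - a) (by omega))
  have h4 := (hiff (t - a) (by omega))
  rw [Nat.add_sub_cancel' (by omega)] at h3 h4
  exact h4.2 (h3.1 hneg)

/-- Spiral lemma. A walk with coordinates `x, y` goes up along `[a, b]`, down along `[b, c]` and
up along `[c, d]` with respect to `ε * (x + y)`, turning left at `b` and `c`. If the second piece
is not longer than the first, then the third is shorter than the second. -/
theorem spiral_lt {x y : ℕ → ℤ} {ε : ℤ} (hε : ε = 1 ∨ ε = -1) {a b c d : ℕ}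
    (hab : a < b) (hbc : b < c)
    (hinj : ∀ i j, a ≤ i → i ≤ d → a ≤ j → j ≤ d → x i = x j → y i = y j → i = j)
    (h1 : ∀ i, a ≤ i → i < b → (x (i + 1) = x i ∧ y (i + 1) = y i + ε) ∨
      (x (i + 1) = x i + ε ∧ y (i + 1) = y i))
    (h2 : ∀ i, b ≤ i → i < c → (x (i + 1) = x i ∧ y (i + 1) = y i - ε) ∨
      (x (i + 1) = x i - ε ∧ y (i + 1) = y i))
    (h3 : ∀ i, c ≤ i → i < d → (x (i + 1) = x i ∧ y (i + 1) = y i + ε) ∨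
      (x (i + 1) = x i + ε ∧ y (i + 1) = y i))
    (hb : x (b - 1) = x b ∧ x (b + 1) = x b - ε)
    (hc : c < d → x (c - 1) = x c ∧ x (c + 1) = x c + ε)
    (hle : c - b ≤ b - a) : d - c < c - b := by
  by_contra! hcon
  obtain ⟨l, hl⟩ : ∃ l, c = b + l := ⟨c - b, by omega⟩
  have hl0 : 0 < l := by omega
  have hla : l ≤ b - a := by omega
  have hld : b + l + l ≤ d := by omega
  subst hl
  have e1 : ∀ t, t < l → (x (b - t) = x (b - (t + 1)) ∨ x (b - t) = x (b - (t + 1)) + ε) ∧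
      x (b - t) + y (b - t) = x (b - (t + 1)) + y (b - (t + 1)) + ε := by
    intro t ht
    have := h1 (b - (t + 1)) (by omega) (by omega)
    rw [show b - (t + 1) + 1 = b - t by omega] at this
    omega
  have e2 : ∀ t, t < l → (x (b + (t + 1)) = x (b + t) ∨ x (b + (t + 1)) = x (b + t) - ε) ∧
      x (b + (t + 1)) + y (b + (t + 1)) = x (b + t) + y (b + t) - ε := by
    intro t ht
    have := h2 (b + t) (by omega) (by omega)
    rw [show b + t + 1 = b + (t + 1) by omega] at this
    omega
  have e3 : ∀ t, t < l → (x (b + 2 * l - t) = x (b + 2 * l - (t + 1)) ∨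
        x (b + 2 * l - t) = x (b + 2 * l - (t + 1)) + ε) ∧
      x (b + 2 * l - t) + y (b + 2 * l - t) =
        x (b + 2 * l - (t + 1)) + y (b + 2 * l - (t + 1)) + ε := by
    intro t ht
    have := h3 (b + 2 * l - (t + 1)) (by omega) (by omega)
    rw [show b + 2 * l - (t + 1) + 1 = b + 2 * l - t by omega] at this
    omega
  have l2 : ∀ t, t ≤ l → x (b + t) + y (b + t) = x b + y b - ε * t := by
    intro t
    induction t with
    | zero => intro _; simp
    | succ t ih =>
      intro ht
      have := ih (by omega)
      have := (e2 t (by omega)).2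
      push_cast
      linarith
  have l1 : ∀ t, t ≤ l → x (b - t) + y (b - t) = x b + y b - ε * t := by
    intro t
    induction t with
    | zero => intro _; simp
    | succ t ih =>
      intro ht
      have := ih (by omega)
      have := (e1 t (by omega)).2
      push_cast
      linarith
  have l3 : ∀ t, t ≤ l → x (b + 2 * l - (l - t)) + y (b + 2 * l - (l - t)) =
      x b + y b - ε * l + ε * t := by
    intro t
    induction t with
    | zero =>
      intro _
      have := l2 l le_rfl
      rw [show b + 2 * l - (l - 0) = b + l by omega]
      simpa using this
    | succ t ih =>
      intro ht
      have := ih (by omega)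
      have := (e3 (l - (t + 1)) (by omega)).2
      rw [show l - (t + 1) + 1 = l - t by omega] at this
      push_cast
      linarith
  have l3' : ∀ t, t ≤ l → x (b + 2 * l - t) + y (b + 2 * l - t) = x b + y b - ε * t := by
    intro t ht
    have := l3 (l - t) (by omega)
    rw [show l - (l - t) = t by omega, Nat.cast_sub ht] at this
    linarith
  have hε2 : ε * ε = 1 := by rcases hε with rfl | rfl <;> norm_num
  have hε0 : ε ≠ 0 := by rcases hε with rfl | rfl <;> norm_num
  have hcc := hc (by omega)
  have n21 : ∀ t, 1 ≤ t → t ≤ l → ε * (x (b + t) - x (b - t)) < 0 := by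
    refine neg_of_ne_zero_of_step (t₀ := 1) ?_ ?_ le_rfl (by omega) ?_
    · intro t ht1 ht2 h
      have hx := (mul_eq_zero.1 h).resolve_left hε0
      have := hinj (b + t) (b - t) (by omega) (by omega) (by omega) (by omega) (by omega)
        (by have := l1 t ht2; have := l2 t ht2; omega)
      omega
    · intro t ht1 ht2
      have := e1 t ht2
      have := e2 t ht2
      rcases hε with rfl | rfl <;> omega
    · rcases hε with rfl | rfl <;> omega
  have n23 : ∀ t, 0 ≤ t → t ≤ l - 1 → ε * (x (b + t) - x (b + 2 * l - t)) < 0 := by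
    refine neg_of_ne_zero_of_step (t₀ := l - 1) ?_ ?_ (by omega) le_rfl ?_
    · intro t ht1 ht2 h
      have hx := (mul_eq_zero.1 h).resolve_left hε0
      have := hinj (b + t) (b + 2 * l - t) (by omega) (by omega) (by omega) (by omega) (by omega)
        (by have := l3' t (by omega); have := l2 t (by omega); omega)
      omega
    · intro t ht1 ht2
      have := e3 t (by omega)
      have := e2 t (by omega)
      rcases hε with rfl | rfl <;> omega
    · rw [show b + (l - 1) = b + l - 1 by omega, show b + 2 * l - (l - 1) = b + l + 1 by omega]
      rcases hε with rfl | rfl <;> omega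
  have n31 : ∀ t, 0 ≤ t → t ≤ l → ε * (x (b + 2 * l - t) - x (b - t)) < 0 := by
    refine neg_of_ne_zero_of_step (t₀ := l) ?_ ?_ (by omega) le_rfl ?_
    · intro t ht1 ht2 h
      have hx := (mul_eq_zero.1 h).resolve_left hε0
      have := hinj (b + 2 * l - t) (b - t) (by omega) (by omega) (by omega) (by omega) (by omega)
        (by have := l3' t (by omega); have := l1 t (by omega); omega)
      omega
    · intro t ht1 ht2
      have := e3 t (by omega)
      have := e1 t (by omega)
      rcases hε with rfl | rfl <;> omega
    · rw [show b + 2 * l - l = b + l by omega]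
      exact n21 l hl0 le_rfl
  have m1 := n31 0 le_rfl (by omega)
  have m2 := n23 0 le_rfl (by omega)
  simp only [Nat.sub_zero, Nat.add_zero] at m1 m2
  rcases hε with rfl | rfl <;> omega

/-- Extension of a finite walk to a function on `ℕ`, with value `0` past the end. -/
def extendWalk (n : ℕ) (w : Fin (n + 1) → ℤ × ℤ) (i : ℕ) : ℤ × ℤ :=
  if h : i < n + 1 then w ⟨i, h⟩ else 0

theorem extendWalk_of_lt {n : ℕ} (w : Fin (n + 1) → ℤ × ℤ) {i : ℕ} (h : i < n + 1) :
    extendWalk n w i = w ⟨i, h⟩ := dif_pos h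

theorem walkStep_eq_extendWalk {n : ℕ} (w : Fin (n + 1) → ℤ × ℤ) {i : ℕ} (h : i < n) :
    walkStep n w ⟨i, h⟩ = extendWalk n w (i + 1) - extendWalk n w i := by
  rw [extendWalk_of_lt w (show i + 1 < n + 1 by omega), extendWalk_of_lt w (show i < n + 1 by omega)]
  rfl

theorem ext_of_extendWalk {n : ℕ} {w w' : Fin (n + 1) → ℤ × ℤ}
    (h : ∀ i ≤ n, extendWalk n w i = extendWalk n w' i) : w = w' := by
  funext i
  have := h i (by omega)
  rwa [extendWalk_of_lt w i.isLt, extendWalk_of_lt w' i.isLt] at this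

/-- The `i`-th step of the walk `W` goes north or east. -/
def IsUpStep (W : ℕ → ℤ × ℤ) (i : ℕ) : Prop :=
  (W (i + 1)).1 + (W (i + 1)).2 = (W i).1 + (W i).2 + 1

instance (W : ℕ → ℤ × ℤ) : DecidablePred (IsUpStep W) := fun _ => Int.instDecidableEq _ _

/-- The vertices where the walk `W` switches between north-east and south-west. -/
def reversals (W : ℕ → ℤ × ℤ) (N : ℕ) : Finset ℕ :=
  (Finset.range N).filter fun i => 0 < i ∧ ¬(IsUpStep W (i - 1) ↔ IsUpStep W i)

theorem isUpStep_iff_of_notMem_reversals {W : ℕ → ℤ × ℤ} {N u : ℕ} :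
    ∀ v, u ≤ v → v < N → (∀ i, u < i → i ≤ v → i ∉ reversals W N) →
      (IsUpStep W v ↔ IsUpStep W u) := by
  intro v huv
  induction v, huv using Nat.le_induction with
  | base => intros; rfl
  | succ v huv ih =>
    intro hv h
    rw [← ih (by omega) fun i hi hi' => h i hi (by omega)]
    have := h (v + 1) (by omega) le_rfl
    simp only [reversals, Finset.mem_filter, Finset.mem_range, not_and, not_not,
      Nat.add_sub_cancel] at this
    exact (this hv (by omega)).symm

/-- The walk `W` takes unit steps, satisfies the three-choice condition, and its first `N`
vertices are distinct. -/
structure IsThreeChoicePath (W : ℕ → ℤ × ℤ) (N : ℕ) : Prop where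
  step : ∀ i < N, ((W (i + 1)).1 = (W i).1 + 1 ∧ (W (i + 1)).2 = (W i).2) ∨
    ((W (i + 1)).1 = (W i).1 - 1 ∧ (W (i + 1)).2 = (W i).2) ∨
    ((W (i + 1)).1 = (W i).1 ∧ (W (i + 1)).2 = (W i).2 + 1) ∨
    ((W (i + 1)).1 = (W i).1 ∧ (W (i + 1)).2 = (W i).2 - 1)
  inj : ∀ i < N, ∀ j < N, (W i).1 = (W j).1 → (W i).2 = (W j).2 → i = j
  east : ∀ i, i + 1 < N → (W (i + 1)).1 = (W i).1 + 1 → IsUpStep W (i + 1)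
  west : ∀ i, i + 1 < N → (W (i + 1)).1 = (W i).1 - 1 → ¬ IsUpStep W (i + 1)

theorem IsThreeChoicePath.up {W : ℕ → ℤ × ℤ} {N i : ℕ} (h : IsThreeChoicePath W N) (hi : i < N)
    (hu : IsUpStep W i) : ((W (i + 1)).1 = (W i).1 ∧ (W (i + 1)).2 = (W i).2 + 1) ∨
      ((W (i + 1)).1 = (W i).1 + 1 ∧ (W (i + 1)).2 = (W i).2) := by
  have := h.step i hi
  unfold IsUpStep at hu
  omega

theorem IsThreeChoicePath.down {W : ℕ → ℤ × ℤ} {N i : ℕ} (h : IsThreeChoicePath W N) (hi : i < N)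
    (hu : ¬ IsUpStep W i) : ((W (i + 1)).1 = (W i).1 ∧ (W (i + 1)).2 = (W i).2 - 1) ∨
      ((W (i + 1)).1 = (W i).1 - 1 ∧ (W (i + 1)).2 = (W i).2) := by
  have := h.step i hi
  unfold IsUpStep at hu
  omega

theorem IsThreeChoicePath.turn_up_down {W : ℕ → ℤ × ℤ} {N i : ℕ} (h : IsThreeChoicePath W N)
    (hi0 : 0 < i) (hi : i + 1 < N) (hu : IsUpStep W (i - 1)) (hd : ¬ IsUpStep W i) :
    (W (i - 1)).1 = (W i).1 ∧ (W (i + 1)).1 = (W i).1 - 1 := by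
  obtain ⟨i, rfl⟩ : ∃ j, i = j + 1 := ⟨i - 1, by omega⟩
  rw [Nat.add_sub_cancel] at *
  have h1 := h.up (i := i) (by omega) hu
  have h2 := h.down (i := i + 1) (by omega) hd
  have h3 := h.inj i (by omega) (i + 1 + 1) hi
  have h4 := mt (h.east i (by omega)) hd
  omega

theorem IsThreeChoicePath.turn_down_up {W : ℕ → ℤ × ℤ} {N i : ℕ} (h : IsThreeChoicePath W N)
    (hi0 : 0 < i) (hi : i + 1 < N) (hd : ¬ IsUpStep W (i - 1)) (hu : IsUpStep W i) :
    (W (i - 1)).1 = (W i).1 ∧ (W (i + 1)).1 = (W i).1 + 1 := by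
  obtain ⟨i, rfl⟩ : ∃ j, i = j + 1 := ⟨i - 1, by omega⟩
  rw [Nat.add_sub_cancel] at *
  have h1 := h.down (i := i) (by omega) hd
  have h2 := h.up (i := i + 1) (by omega) hu
  have h3 := h.inj i (by omega) (i + 1 + 1) hi
  have h4 : (W (i + 1)).1 ≠ (W i).1 - 1 := fun h' => h.west i (by omega) h' hu
  omega

/-- A three-choice path of length `N` has `O(√N)` reversals. -/
theorem IsThreeChoicePath.card_reversals_le {W : ℕ → ℤ × ℤ} {N : ℕ}
    (h : IsThreeChoicePath W N) : (reversals W N).card ≤ 2 * Nat.sqrt (2 * N) + 5 := by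
  have hmem : ∀ i, i ∈ reversals W N ↔ i < N ∧ 0 < i ∧ ¬(IsUpStep W (i - 1) ↔ IsUpStep W i) :=
    fun i => by simp [reversals]
  refine card_le_of_unimodal_gaps (fun i hi => ((hmem i).1 hi).1) ?_
  intro a ha b hb c hc d hd hab hbc hcd hbet hle
  have hdN := ((hmem d).1 hd).1
  have hb' := ((hmem b).1 hb).2.2
  have hc' := ((hmem c).1 hc).2.2
  have k1 : ∀ i, a ≤ i → i < b → (IsUpStep W i ↔ IsUpStep W a) := fun i hi hi' =>
    isUpStep_iff_of_notMem_reversals (N := N) i hi (by omega) fun j h1 h2 hj => by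
      have := hbet j h1 (by omega) hj
      omega
  have k2 : ∀ i, b ≤ i → i < c → (IsUpStep W i ↔ IsUpStep W b) := fun i hi hi' =>
    isUpStep_iff_of_notMem_reversals (N := N) i hi (by omega) fun j h1 h2 hj => by
      have := hbet j (by omega) (by omega) hj
      omega
  have k3 : ∀ i, c ≤ i → i < d → (IsUpStep W i ↔ IsUpStep W c) := fun i hi hi' =>
    isUpStep_iff_of_notMem_reversals (N := N) i hi (by omega) fun j h1 h2 hj => by
      have := hbet j (by omega) (by omega) hj
      omega
  have kb := k1 (b - 1) (by omega) (by omega)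
  have kc := k2 (c - 1) (by omega) (by omega)
  have hinj : ∀ i j, a ≤ i → i ≤ d → a ≤ j → j ≤ d → (W i).1 = (W j).1 → (W i).2 = (W j).2 →
      i = j := fun i j _ _ _ _ => h.inj i (by omega) j (by omega)
  by_cases hua : IsUpStep W a
  · have hub : ¬ IsUpStep W b := by tauto
    have huc : IsUpStep W c := by tauto
    refine spiral_lt (x := fun i => (W i).1) (y := fun i => (W i).2) (ε := 1) (Or.inl rfl) hab hbc
      hinj ?_ ?_ ?_ ?_ ?_ hle
    · exact fun i h1 h2 => h.up (by omega) ((k1 i h1 h2).2 hua)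
    · exact fun i h1 h2 => h.down (by omega) (mt (k2 i h1 h2).1 hub)
    · exact fun i h1 h2 => h.up (by omega) ((k3 i h1 h2).2 huc)
    · exact h.turn_up_down (by omega) (by omega) (kb.2 hua) hub
    · exact fun _ => h.turn_down_up (by omega) (by omega) (mt kc.1 hub) huc
  · have hub : IsUpStep W b := by tauto
    have huc : ¬ IsUpStep W c := by tauto
    refine spiral_lt (x := fun i => (W i).1) (y := fun i => (W i).2) (ε := -1) (Or.inr rfl) hab hbc
      hinj ?_ ?_ ?_ ?_ ?_ hle
    · exact fun i h1 h2 => h.down (by omega) (mt (k1 i h1 h2).1 hua)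
    · intro i h1 h2
      simpa using h.up (by omega) ((k2 i h1 h2).2 hub)
    · exact fun i h1 h2 => h.down (by omega) (mt (k3 i h1 h2).1 huc)
    · simpa using h.turn_down_up (by omega) (by omega) (mt kb.1 hua) hub
    · exact fun _ => h.turn_up_down (by omega) (by omega) (kc.2 hub) huc

/-- A path with unit steps is determined by its start, which of its steps are horizontal, its
first direction, and its reversals. -/
theorem IsThreeChoicePath.eq_of_reversals_eq {W W' : ℕ → ℤ × ℤ} {N : ℕ}
    (h : IsThreeChoicePath W N) (h' : IsThreeChoicePath W' N) (h0 : W 0 = W' 0)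
    (hhor : ∀ i < N, ((W (i + 1)).2 = (W i).2 ↔ (W' (i + 1)).2 = (W' i).2))
    (hup : IsUpStep W 0 ↔ IsUpStep W' 0) (hrev : reversals W N = reversals W' N) :
    ∀ i ≤ N, W i = W' i := by
  have hups : ∀ i < N, (IsUpStep W i ↔ IsUpStep W' i) := by
    intro i
    induction i with
    | zero => exact fun _ => hup
    | succ i ih =>
      intro hi
      have h1 := ih (by omega)
      have h2 : i + 1 ∈ reversals W N ↔ i + 1 ∈ reversals W' N := by rw [hrev]
      simp only [reversals, Finset.mem_filter, Finset.mem_range, Nat.add_sub_cancel, hi,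
        Nat.succ_pos, true_and] at h2
      tauto
  intro i
  induction i with
  | zero => exact fun _ => h0
  | succ i ih =>
    intro hi
    have h1 := ih (by omega)
    have h2 := hups i (by omega)
    have h3 := hhor i (by omega)
    have h4 := h.step i (by omega)
    have h5 := h'.step i (by omega)
    unfold IsUpStep at h2
    rw [h1] at h2 h3 h4
    ext <;> omega

theorem IsThreeChoicePolygon.isThreeChoicePath {n : ℕ} {w : Fin (2 * n + 1) → ℤ × ℤ}
    (h : IsThreeChoicePolygon n w) : IsThreeChoicePath (extendWalk (2 * n) w) (2 * n) := by
  obtain ⟨-, -, hstep, hinj, htc⟩ := h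
  have hs : ∀ i < 2 * n, extendWalk (2 * n) w (i + 1) - extendWalk (2 * n) w i ∈
      ({(1, 0), (-1, 0), (0, 1), (0, -1)} : Set (ℤ × ℤ)) := fun i hi => by
    rw [← walkStep_eq_extendWalk w hi]
    exact hstep _
  refine ⟨?_, ?_, ?_, ?_⟩
  · intro i hi
    have := hs i hi
    simp only [Set.mem_insert_iff, Set.mem_singleton_iff, Prod.ext_iff, Prod.fst_sub,
      Prod.snd_sub] at this
    omega
  · intro i hi j hj h1 h2
    have h3 := hinj ⟨i, hi⟩ ⟨j, hj⟩
    have h4 : extendWalk (2 * n) w i = extendWalk (2 * n) w j := Prod.ext h1 h2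
    rw [extendWalk_of_lt w (by omega), extendWalk_of_lt w (by omega)] at h4
    simpa using h3 h4
  · intro i hi h1
    have h2 := (htc ⟨i, by omega⟩ ⟨i + 1, hi⟩ rfl).1
    have h3 := hs i (by omega)
    rw [walkStep_eq_extendWalk, walkStep_eq_extendWalk] at h2
    simp only [Set.mem_insert_iff, Set.mem_singleton_iff, Prod.ext_iff, Prod.fst_sub,
      Prod.snd_sub] at h2 h3
    unfold IsUpStep
    omega
  · intro i hi h1
    have h2 := (htc ⟨i, by omega⟩ ⟨i + 1, hi⟩ rfl).2
    have h3 := hs i (by omega)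
    rw [walkStep_eq_extendWalk, walkStep_eq_extendWalk] at h2
    simp only [Set.mem_insert_iff, Set.mem_singleton_iff, Prod.ext_iff, Prod.fst_sub,
      Prod.snd_sub] at h2 h3
    unfold IsUpStep
    omega

/-- The subsets of `{0, …, N - 1}` with at most `K` elements. -/
def smallSubsets (N K : ℕ) : Finset (Finset ℕ) :=
  (Finset.range N).powerset.filter fun S => S.card ≤ K

theorem card_smallSubsets_le (N K : ℕ) : (smallSubsets N K).card ≤ (K + 1) * (N + 1) ^ K := by
  have hsub : smallSubsets N K ⊆
      (Finset.range (K + 1)).biUnion fun k => (Finset.range N).powersetCard k := by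
    intro S hS
    simp only [smallSubsets, Finset.mem_filter, Finset.mem_powerset] at hS
    simp only [Finset.mem_biUnion, Finset.mem_range, Finset.mem_powersetCard]
    exact ⟨S.card, by omega, hS.1, rfl⟩
  calc (smallSubsets N K).card ≤ _ := Finset.card_le_card hsub
    _ ≤ ∑ k ∈ Finset.range (K + 1), ((Finset.range N).powersetCard k).card :=
        Finset.card_biUnion_le
    _ ≤ ∑ k ∈ Finset.range (K + 1), (N + 1) ^ K := by
        refine Finset.sum_le_sum fun k hk => ?_
        rw [Finset.card_powersetCard, Finset.card_range]
        calc N.choose k ≤ N ^ k := Nat.choose_le_pow N k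
          _ ≤ (N + 1) ^ k := Nat.pow_le_pow_left (by omega) k
          _ ≤ (N + 1) ^ K :=
            Nat.pow_le_pow_right (by omega) (by have := Finset.mem_range.1 hk; omega)
    _ = _ := by simp

/-- The data determining a three-choice polygon: the horizontal steps, the first direction, and
the reversals. -/
def polygonCode (n : ℕ) (w : {w : Fin (2 * n + 1) → ℤ × ℤ // IsThreeChoicePolygon n w}) :
    (Fin (2 * n) → Bool) × Bool × smallSubsets (2 * n) (2 * Nat.sqrt (2 * (2 * n)) + 5) :=
  (fun i => decide ((extendWalk (2 * n) w.1 (i + 1)).2 = (extendWalk (2 * n) w.1 i).2),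
    decide (IsUpStep (extendWalk (2 * n) w.1) 0),
    ⟨reversals (extendWalk (2 * n) w.1) (2 * n), by
      simp only [smallSubsets, Finset.mem_filter, Finset.mem_powerset]
      exact ⟨Finset.filter_subset _ _, w.2.isThreeChoicePath.card_reversals_le⟩⟩)

theorem polygonCode_injective (n : ℕ) : Function.Injective (polygonCode n) := by
  intro w w' h
  simp only [polygonCode, Prod.mk.injEq, Subtype.mk.injEq, decide_eq_decide] at h
  obtain ⟨h1, h2, h3⟩ := h
  refine Subtype.ext (ext_of_extendWalk ?_)
  refine w.2.isThreeChoicePath.eq_of_reversals_eq w'.2.isThreeChoicePath ?_ ?_ h2 h3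
  · rw [extendWalk_of_lt _ (by omega), extendWalk_of_lt _ (by omega)]
    exact w.2.1.trans w'.2.1.symm
  · intro i hi
    simpa using congrFun h1 ⟨i, hi⟩

instance finite_threeChoicePolygon (n : ℕ) :
    Finite {w : Fin (2 * n + 1) → ℤ × ℤ // IsThreeChoicePolygon n w} :=
  Finite.of_injective _ (polygonCode_injective n)

theorem threeChoicePolygonCount_le {n : ℕ} (hn : 1 ≤ n) :
    threeChoicePolygonCount n ≤ 4 ^ n * subexpFactor n := by
  set K := 2 * Nat.sqrt (2 * (2 * n)) + 5 with hK
  have hrev : reversalBound n = K + 1 := by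
    simp only [reversalBound, hK, show 2 * (2 * n) = 4 * n by ring]
  have h1 : threeChoicePolygonCount n ≤ 2 ^ (2 * n) * (2 * (smallSubsets (2 * n) K).card) := by
    have := Nat.card_le_card_of_injective _ (polygonCode_injective n)
    rw [hK, threeChoicePolygonCount]
    simpa only [Nat.card_eq_fintype_card, Fintype.card_prod, Fintype.card_pi, Fintype.card_bool,
      Finset.prod_const, Finset.card_univ, Fintype.card_fin, Fintype.card_coe] using this
  have h2 : K + 1 ≤ (2 * n + 1) ^ K :=
    Nat.lt_pow_self (by omega)
  calc threeChoicePolygonCount n ≤ 2 ^ (2 * n) * (2 * (smallSubsets (2 * n) K).card) := h1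
    _ ≤ 2 ^ (2 * n) * ((2 * n + 1) * ((2 * n + 1) ^ K * (2 * n + 1) ^ K)) := by
        gcongr
        · omega
        · exact (card_smallSubsets_le _ _).trans (Nat.mul_le_mul_right _ h2)
    _ ≤ 2 ^ (2 * n) * ((2 * n + 1) * ((2 * n + 1) ^ K * (2 * n + 1) ^ K)) * (2 * n + 1) :=
        Nat.le_mul_of_pos_right _ (by omega)
    _ = 4 ^ n * subexpFactor n := by
        rw [pow_mul, subexpFactor, hrev]
        ring

/-- The number of up-steps among the letters of even index `0, 2, …, 2(i-1)`. -/
def DyckWord.evenUps (D : DyckWord) (i : ℕ) : ℕ :=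
  ∑ j ∈ Finset.range i, if D.toList[2 * j]? = some DyckStep.U then 1 else 0

/-- The number of down-steps among the letters of odd index `1, 3, …, 2i-1`. -/
def DyckWord.oddDowns (D : DyckWord) (i : ℕ) : ℕ :=
  ∑ j ∈ Finset.range i, if D.toList[2 * j + 1]? = some DyckStep.D then 1 else 0

/-- A pair of sequences starting at `0` with increments in `{0, 1}`, ordered, constant from `m`
on, and equal from `m` on: the horizontal coordinates of two weakly nested directed paths. -/
structure IsNestedPair (m : ℕ) (X Y : ℕ → ℕ) : Prop where
  fst_zero : X 0 = 0
  snd_zero : Y 0 = 0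
  fst_step : ∀ i, X (i + 1) = X i ∨ X (i + 1) = X i + 1
  snd_step : ∀ i, Y (i + 1) = Y i ∨ Y (i + 1) = Y i + 1
  le : ∀ i ≤ m, Y i ≤ X i
  fst_succ : X (m + 1) = X m
  last : X m = Y m

theorem IsNestedPair.fst_le {m : ℕ} {X Y : ℕ → ℕ} (h : IsNestedPair m X Y) (i : ℕ) : X i ≤ i := by
  induction i with
  | zero => exact h.fst_zero.le
  | succ i ih => have := h.fst_step i; omega

theorem IsNestedPair.snd_le {m : ℕ} {X Y : ℕ → ℕ} (h : IsNestedPair m X Y) (i : ℕ) : Y i ≤ i := by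
  induction i with
  | zero => exact h.snd_zero.le
  | succ i ih => have := h.snd_step i; omega

theorem DyckWord.evenUps_succ (D : DyckWord) (i : ℕ) : D.evenUps (i + 1) =
    D.evenUps i + if D.toList[2 * i]? = some DyckStep.U then 1 else 0 :=
  Finset.sum_range_succ _ _

theorem DyckWord.oddDowns_succ (D : DyckWord) (i : ℕ) : D.oddDowns (i + 1) =
    D.oddDowns i + if D.toList[2 * i + 1]? = some DyckStep.D then 1 else 0 :=
  Finset.sum_range_succ _ _

theorem DyckWord.count_take_two_mul (D : DyckWord) : ∀ i ≤ D.semilength,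
    (D.toList.take (2 * i)).count DyckStep.U + D.oddDowns i = D.evenUps i + i ∧
    (D.toList.take (2 * i)).count DyckStep.D + D.evenUps i = D.oddDowns i + i := by
  intro i
  induction i with
  | zero => intro _; simp [evenUps, oddDowns]
  | succ i ih =>
    intro hi
    obtain ⟨h1, h2⟩ := ih (by omega)
    have hlen := D.two_mul_semilength_eq_length
    have g1 : D.toList[2 * i]? = some (D.toList[2 * i]'(by omega)) :=
      List.getElem?_eq_getElem (by omega)
    have g2 : D.toList[2 * i + 1]? = some (D.toList[2 * i + 1]'(by omega)) :=
      List.getElem?_eq_getElem (by omega)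
    rw [evenUps_succ, oddDowns_succ, show 2 * (i + 1) = 2 * i + 1 + 1 by ring, List.take_add_one,
      List.take_add_one, g1, g2]
    simp only [Option.toList_some, List.count_append, List.count_singleton, Option.some.injEq]
    rcases DyckStep.dichotomy (D.toList[2 * i]'(by omega)) with h3 | h3 <;>
    rcases DyckStep.dichotomy (D.toList[2 * i + 1]'(by omega)) with h4 | h4 <;>
    simp only [h3, h4, beq_iff_eq, reduceCtorEq, if_true, if_false] <;> omega

theorem DyckWord.isNestedPair (D : DyckWord) :
    IsNestedPair D.semilength D.evenUps D.oddDowns where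
  fst_zero := by simp [evenUps]
  snd_zero := by simp [oddDowns]
  fst_step i := by rw [evenUps_succ]; split_ifs <;> simp
  snd_step i := by rw [oddDowns_succ]; split_ifs <;> simp
  le i hi := by
    have := D.count_take_two_mul i hi
    have := D.count_D_le_count_U (2 * i)
    omega
  fst_succ := by
    rw [evenUps_succ, List.getElem?_eq_none (by rw [D.two_mul_semilength_eq_length])]
    simp
  last := by
    have h := D.count_take_two_mul _ le_rfl
    rw [List.take_of_length_le (by rw [D.two_mul_semilength_eq_length]),
      ← DyckWord.semilength_eq_count_D] at h
    omega

theorem DyckWord.eq_of_evenUps_eq_of_oddDowns_eq {D D' : DyckWord} {m : ℕ}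
    (hD : D.semilength = m) (hD' : D'.semilength = m)
    (hX : ∀ i ≤ m, D.evenUps i = D'.evenUps i) (hY : ∀ i ≤ m, D.oddDowns i = D'.oddDowns i) :
    D = D' := by
  have hlen := D.two_mul_semilength_eq_length
  have hlen' := D'.two_mul_semilength_eq_length
  refine DyckWord.ext (List.ext_getElem (by omega) fun k hk hk' => ?_)
  have hU : ∀ s t : DyckStep, (s = DyckStep.U ↔ t = DyckStep.U) → s = t := by
    rintro (_ | _) (_ | _) <;> simp
  have hD : ∀ s t : DyckStep, (s = DyckStep.D ↔ t = DyckStep.D) → s = t := by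
    rintro (_ | _) (_ | _) <;> simp
  obtain ⟨i, rfl | rfl⟩ : ∃ i, k = 2 * i ∨ k = 2 * i + 1 := ⟨k / 2, by omega⟩
  · apply hU
    have h1 := hX i (by omega)
    have h2 := hX (i + 1) (by omega)
    simp only [evenUps_succ, List.getElem?_eq_getElem hk, List.getElem?_eq_getElem hk',
      Option.some.injEq] at h2
    split_ifs at h2 <;> first | tauto | omega
  · apply hD
    have h1 := hY i (by omega)
    have h2 := hY (i + 1) (by omega)
    simp only [oddDowns_succ, List.getElem?_eq_getElem hk, List.getElem?_eq_getElem hk',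
      Option.some.injEq] at h2
    split_ifs at h2 <;> first | tauto | omega

theorem four_pow_le_subexpFactor_mul_catalan {n m : ℕ} (hn : n ≤ m + 5) (hm : 1 ≤ m)
    (hmn : m ≤ n) : 4 ^ n ≤ catalan m * subexpFactor n := by
  have h1 := Nat.four_pow_le_two_mul_self_mul_centralBinom m hm
  rw [← succ_mul_catalan_eq_centralBinom] at h1
  have h3 : (2 * n + 1) ^ 12 ≤ subexpFactor n :=
    Nat.pow_le_pow_right (by omega) (by simp only [reversalBound]; omega)
  calc 4 ^ n ≤ 4 ^ (m + 5) := Nat.pow_le_pow_right (by norm_num) hn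
    _ = 4 ^ m * 4 ^ 5 := pow_add _ _ _
    _ ≤ (2 * m * ((m + 1) * catalan m)) * 4 ^ 5 := by gcongr
    _ = catalan m * ((2 * m) * (m + 1) * 4 ^ 5) := by ring
    _ ≤ catalan m * ((2 * n + 1) * (2 * n + 1) * 3 ^ 10) := by
        refine Nat.mul_le_mul_left _ (Nat.mul_le_mul (Nat.mul_le_mul ?_ ?_) (by norm_num)) <;> omega
    _ ≤ catalan m * ((2 * n + 1) * (2 * n + 1) * (2 * n + 1) ^ 10) := by
        gcongr
        omega
    _ = catalan m * (2 * n + 1) ^ 12 := by ring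
    _ ≤ _ := by gcongr

/-- The directed path whose `i`-th vertex has horizontal coordinate `u i`. -/
def directedPath (n : ℕ) (u : ℕ → ℕ) (i : Fin (n + 1)) : ℤ × ℤ := (u i, (i : ℕ) - u i)

theorem isDirectedPath_directedPath {n : ℕ} {u : ℕ → ℕ}
    (hu : ∀ i < n, u (i + 1) = u i ∨ u (i + 1) = u i + 1) :
    IsDirectedPath n (directedPath n u) := by
  intro i
  have := hu i i.isLt
  simp only [directedPath, Fin.val_succ, Fin.val_castSucc, Prod.ext_iff, Prod.fst_sub,
    Prod.snd_sub]
  push_cast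
  omega

theorem IsDirectedPath.level {n : ℕ} {p : Fin (n + 1) → ℤ × ℤ} (hp : IsDirectedPath n p)
    (h0 : p 0 = (0, 0)) (i : Fin (n + 1)) : (p i).1 + (p i).2 = (i : ℕ) := by
  induction i using Fin.induction with
  | zero => simp [h0]
  | succ i ih =>
    have := hp i
    simp only [Prod.ext_iff, Prod.fst_sub, Prod.snd_sub] at this
    rw [Fin.val_castSucc] at ih
    rw [Fin.val_succ]
    push_cast
    omega

/-- The horizontal steps of a directed path. -/
def pathCode (n : ℕ) (p : {p : Fin (n + 1) → ℤ × ℤ // IsDirectedPath n p ∧ p 0 = (0, 0)}) :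
    Fin n → Bool :=
  fun i => decide (p.1 i.succ - p.1 i.castSucc = (1, 0))

theorem pathCode_injective (n : ℕ) : Function.Injective (pathCode n) := by
  rintro ⟨p, hp, hp0⟩ ⟨q, hq, hq0⟩ h
  refine Subtype.ext (funext fun i => ?_)
  induction i using Fin.induction with
  | zero => exact hp0.trans hq0.symm
  | succ i ih =>
    have h1 := congrFun h i
    simp only [pathCode, decide_eq_decide] at h1
    have h2 : p i.succ - p i.castSucc = q i.succ - q i.castSucc := by
      rcases hp i with h3 | h3 <;> rcases hq i with h4 | h4 <;> simp_all
    simp only at ih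
    rw [ih] at h2
    exact sub_left_injective h2

theorem finite_directedPaths (n : ℕ) :
    Finite {p : Fin (n + 1) → ℤ × ℤ // IsDirectedPath n p ∧ p 0 = (0, 0)} :=
  Finite.of_injective _ (pathCode_injective n)

theorem card_directedPaths_le (n : ℕ) :
    Nat.card {p : Fin (n + 1) → ℤ × ℤ // IsDirectedPath n p ∧ p 0 = (0, 0)} ≤ 2 ^ n := by
  simpa using Nat.card_le_card_of_injective _ (pathCode_injective n)

/-- A pair of directed paths with the given boundary paths, as a code for a staircase polygon. -/
theorem exists_staircaseCode (n : ℕ) : ∃ f : {s : Sym2 (Fin (n + 1) → ℤ × ℤ) //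
      ∃ p q, s = s(p, q) ∧ IsStaircasePair n p q} →
    {p : Fin (n + 1) → ℤ × ℤ // IsDirectedPath n p ∧ p 0 = (0, 0)} ×
    {p : Fin (n + 1) → ℤ × ℤ // IsDirectedPath n p ∧ p 0 = (0, 0)}, Function.Injective f := by
  choose p q hs hpq using fun s : {s : Sym2 (Fin (n + 1) → ℤ × ℤ) //
      ∃ p q, s = s(p, q) ∧ IsStaircasePair n p q} => s.2
  refine ⟨fun s => (⟨p s, (hpq s).1, (hpq s).2.2.1⟩, ⟨q s, (hpq s).2.1, (hpq s).2.2.2.1⟩), ?_⟩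
  intro s t h
  simp only [Prod.mk.injEq, Subtype.mk.injEq] at h
  rw [Subtype.ext_iff, hs s, hs t, h.1, h.2]

instance finite_staircase (n : ℕ) : Finite {s : Sym2 (Fin (n + 1) → ℤ × ℤ) //
    ∃ p q, s = s(p, q) ∧ IsStaircasePair n p q} := by
  have := finite_directedPaths n
  obtain ⟨f, hf⟩ := exists_staircaseCode n
  exact Finite.of_injective f hf

theorem staircaseCount_le (n : ℕ) : staircaseCount n ≤ 4 ^ n := by
  have := finite_directedPaths n
  obtain ⟨f, hf⟩ := exists_staircaseCode n
  calc staircaseCount n ≤ _ := Nat.card_le_card_of_injective f hf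
    _ ≤ 2 ^ n * 2 ^ n := by
      rw [Nat.card_prod]
      exact Nat.mul_le_mul (card_directedPaths_le n) (card_directedPaths_le n)
    _ = 4 ^ n := by rw [← mul_pow]; norm_num

/-- Horizontal coordinates of the lower path: an east step, then `X`, then a north step. -/
def lowerCoord (X : ℕ → ℕ) (i : ℕ) : ℕ := if i = 0 then 0 else X (i - 1) + 1

/-- Horizontal coordinates of the upper path: a north step, then `Y`, then an east step. -/
def upperCoord (m : ℕ) (Y : ℕ → ℕ) (i : ℕ) : ℕ := Y (min (i - 1) m) + if i = m + 2 then 1 else 0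

theorem IsNestedPair.isStaircasePair {m : ℕ} {X Y : ℕ → ℕ} (h : IsNestedPair m X Y) :
    IsStaircasePair (m + 2) (directedPath (m + 2) (lowerCoord X))
      (directedPath (m + 2) (upperCoord m Y)) := by
  have hlt : ∀ i, 0 < i → i < m + 2 → upperCoord m Y i < lowerCoord X i := fun i h0 hi => by
    have := h.le (i - 1) (by omega)
    simp only [upperCoord, lowerCoord, min_eq_left (show i - 1 ≤ m by omega)]
    split_ifs <;> omega
  refine ⟨isDirectedPath_directedPath ?_, isDirectedPath_directedPath ?_, ?_, ?_, ?_, ?_, ?_⟩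
  · intro i hi
    rcases i with _ | i
    · simp [lowerCoord, h.fst_zero]
    · have := h.fst_step i
      simp only [lowerCoord, Nat.add_sub_cancel, Nat.succ_ne_zero, if_false]
      omega
  · intro i hi
    rcases i with _ | i
    · simp [upperCoord, h.snd_zero]
    · simp only [upperCoord, Nat.add_sub_cancel]
      rcases Nat.lt_or_ge i m with him | him
      · have := h.snd_step i
        rw [min_eq_left him, min_eq_left him.le]
        split_ifs <;> omega
      · rw [min_eq_right (by omega), min_eq_right (by omega)]
        split_ifs <;> omega
  · simp [directedPath, lowerCoord]
  · simp [directedPath, upperCoord, h.snd_zero]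
  · intro heq
    have h1 := hlt 1 (by omega) (by omega)
    have h2 := congrArg Prod.fst (congrFun heq ⟨1, by omega⟩)
    simp only [directedPath] at h2
    omega
  · have h1 : lowerCoord X (m + 2) = upperCoord m Y (m + 2) := by
      simp [lowerCoord, upperCoord, h.fst_succ, h.last]
    simp [directedPath, h1]
  · intro i j hij
    simp only [directedPath, Prod.mk.injEq] at hij
    have h1 : (i : ℕ) = j := by omega
    have h2 := hlt i
    rw [Fin.ext_iff, Fin.ext_iff, Fin.ext_iff, Fin.ext_iff, Fin.val_zero, Fin.val_last, ← h1]
    have h3 := i.isLt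
    rw [← h1] at hij
    omega

theorem catalan_le_staircaseCount (m : ℕ) : catalan m ≤ staircaseCount (m + 2) := by
  rw [← DyckWord.card_dyckWord_semilength_eq_catalan, ← Nat.card_eq_fintype_card, staircaseCount]
  have hpair : ∀ D : {p : DyckWord // p.semilength = m},
      IsNestedPair m D.1.evenUps D.1.oddDowns := fun D => by
    have := D.1.isNestedPair
    rwa [D.2] at this
  refine Nat.card_le_card_of_injective (fun D => ⟨_, _, _, rfl, (hpair D).isStaircasePair⟩) ?_
  intro D D' h
  have hD := hpair D
  have hD' := hpair D'
  simp only [Subtype.mk.injEq, Sym2.eq_iff] at h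
  have hfirst : ∀ {u v : ℕ → ℕ}, directedPath (m + 2) u = directedPath (m + 2) v →
      ∀ i < m + 3, u i = v i := fun {u v} huv i hi => by
    have := congrArg Prod.fst (congrFun huv ⟨i, hi⟩)
    simpa [directedPath] using this
  rcases h with ⟨h1, h2⟩ | ⟨h1, -⟩
  · refine Subtype.ext (DyckWord.eq_of_evenUps_eq_of_oddDowns_eq D.2 D'.2 ?_ ?_)
    · intro i hi
      simpa [lowerCoord] using hfirst h1 (i + 1) (by omega)
    · intro i hi
      have := hfirst h2 (i + 1) (by omega)
      simpa [upperCoord, hi, show i ≠ m + 1 by omega] using this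
  · have := hfirst h1 1 (by omega)
    simp [lowerCoord, upperCoord, hD'.snd_zero] at this

/-- A three-choice polygon with a dent at the origin: up along `X`, down along the path with
horizontal coordinates `Y - 1`, and back to the origin around the square below it. -/
def dentedWalk (m : ℕ) (X Y : ℕ → ℕ) (i : ℕ) : ℤ × ℤ :=
  if i ≤ m + 2 then (X (i - 1), i - X (i - 1))
  else if i ≤ 2 * m + 6 then (Y (2 * m + 3 - i) - 1, 2 * m + 5 - i - Y (2 * m + 3 - i))
  else if i = 2 * m + 7 then (0, -1)
  else if i = 2 * m + 8 then (1, -1)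
  else if i = 2 * m + 9 then (1, 0)
  else (0, 0)

section DentedWalk

variable {m : ℕ} {X Y : ℕ → ℕ}

theorem dentedWalk_of_le {i : ℕ} (hi : i ≤ m + 2) :
    (dentedWalk m X Y i).1 = X (i - 1) ∧ (dentedWalk m X Y i).2 = i - X (i - 1) := by
  simp [dentedWalk, hi]

theorem dentedWalk_of_lt_of_le {i : ℕ} (hi : m + 2 < i) (hi' : i ≤ 2 * m + 6) :
    (dentedWalk m X Y i).1 = Y (2 * m + 3 - i) - 1 ∧
      (dentedWalk m X Y i).2 = 2 * m + 5 - i - Y (2 * m + 3 - i) := by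
  simp [dentedWalk, hi', hi.not_ge]

theorem dentedWalk_add_seven : dentedWalk m X Y (2 * m + 7) = (0, -1) := by
  simp [dentedWalk, show ¬ 2 * m + 7 ≤ m + 2 by omega]

theorem dentedWalk_add_eight : dentedWalk m X Y (2 * m + 8) = (1, -1) := by
  simp [dentedWalk, show ¬ 2 * m + 8 ≤ m + 2 by omega]

theorem dentedWalk_add_nine : dentedWalk m X Y (2 * m + 9) = (1, 0) := by
  simp [dentedWalk, show ¬ 2 * m + 9 ≤ m + 2 by omega]

theorem dentedWalk_add_ten : dentedWalk m X Y (2 * m + 10) = (0, 0) := by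
  simp [dentedWalk, show ¬ 2 * m + 10 ≤ m + 2 by omega]

theorem IsNestedPair.dentedWalk_step_up (h : IsNestedPair m X Y) {i : ℕ} (hi : i ≤ m + 1) :
    dentedWalk m X Y (i + 1) - dentedWalk m X Y i = (0, 1) ∨
      (i ≤ m ∧ dentedWalk m X Y (i + 1) - dentedWalk m X Y i = (1, 0)) := by
  have h1 := dentedWalk_of_le (m := m) (X := X) (Y := Y) (i := i) (by omega)
  have h2 := dentedWalk_of_le (m := m) (X := X) (Y := Y) (i := i + 1) (by omega)
  have hX := h.fst_succ
  simp only [Prod.ext_iff, Prod.fst_sub, Prod.snd_sub]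
  rcases i with _ | i
  · simp only [Nat.zero_sub, zero_add, Nat.sub_self, Nat.cast_zero, Nat.cast_one] at h1 h2 ⊢
    omega
  · have h3 := h.fst_step i
    simp only [Nat.add_sub_cancel] at h1 h2
    rcases Nat.lt_or_ge i m with him | him
    · omega
    · obtain rfl : i = m := by omega
      omega

theorem IsNestedPair.dentedWalk_step_top (h : IsNestedPair m X Y) :
    dentedWalk m X Y (m + 2 + 1) - dentedWalk m X Y (m + 2) = (-1, 0) := by
  have h1 := dentedWalk_of_le (m := m) (X := X) (Y := Y) (i := m + 2) (by omega)
  have h2 := dentedWalk_of_lt_of_le (m := m) (X := X) (Y := Y) (i := m + 2 + 1) (by omega)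
    (by omega)
  rw [show m + 2 - 1 = m + 1 by omega, h.fst_succ] at h1
  rw [show 2 * m + 3 - (m + 2 + 1) = m by omega, ← h.last] at h2
  simp only [Prod.ext_iff, Prod.fst_sub, Prod.snd_sub]
  omega

theorem IsNestedPair.dentedWalk_step_down (h : IsNestedPair m X Y) {i : ℕ} (hi : m + 2 < i)
    (hi' : i ≤ 2 * m + 5) :
    dentedWalk m X Y (i + 1) - dentedWalk m X Y i = (0, -1) ∨
      (i ≤ 2 * m + 2 ∧ dentedWalk m X Y (i + 1) - dentedWalk m X Y i = (-1, 0)) := by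
  have h1 := dentedWalk_of_lt_of_le (m := m) (X := X) (Y := Y) (i := i) (by omega) (by omega)
  have h2 := dentedWalk_of_lt_of_le (m := m) (X := X) (Y := Y) (i := i + 1) (by omega) (by omega)
  simp only [Prod.ext_iff, Prod.fst_sub, Prod.snd_sub]
  rcases Nat.lt_or_ge (2 * m + 2) i with him | him
  · rw [show 2 * m + 3 - i = 0 by omega] at h1
    rw [show 2 * m + 3 - (i + 1) = 0 by omega] at h2
    omega
  · have h3 := h.snd_step (2 * m + 3 - (i + 1))
    rw [show 2 * m + 3 - (i + 1) + 1 = 2 * m + 3 - i by omega] at h3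
    omega

theorem IsNestedPair.dentedWalk_step_bottom (h : IsNestedPair m X Y) :
    dentedWalk m X Y (2 * m + 6 + 1) - dentedWalk m X Y (2 * m + 6) = (1, 0) := by
  have h1 := dentedWalk_of_lt_of_le (m := m) (X := X) (Y := Y) (i := 2 * m + 6) (by omega)
    (by omega)
  rw [show 2 * m + 3 - (2 * m + 6) = 0 by omega, h.snd_zero] at h1
  rw [dentedWalk_add_seven]
  simp only [Prod.ext_iff, Prod.fst_sub, Prod.snd_sub]
  omega

theorem IsNestedPair.dentedWalk_step_cases (h : IsNestedPair m X Y) {i : ℕ} (hi : i < 2 * m + 10) :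
    (i ≤ m + 1 ∧ dentedWalk m X Y (i + 1) - dentedWalk m X Y i = (0, 1)) ∨
    (i ≤ m ∧ dentedWalk m X Y (i + 1) - dentedWalk m X Y i = (1, 0)) ∨
    (m + 2 ≤ i ∧ i ≤ 2 * m + 5 ∧ dentedWalk m X Y (i + 1) - dentedWalk m X Y i = (0, -1)) ∨
    (m + 2 ≤ i ∧ i ≤ 2 * m + 2 ∧ dentedWalk m X Y (i + 1) - dentedWalk m X Y i = (-1, 0)) ∨
    (2 * m + 6 ≤ i ∧ i ≤ 2 * m + 7 ∧ dentedWalk m X Y (i + 1) - dentedWalk m X Y i = (1, 0)) ∨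
    (i = 2 * m + 8 ∧ dentedWalk m X Y (i + 1) - dentedWalk m X Y i = (0, 1)) ∨
    (i = 2 * m + 9 ∧ dentedWalk m X Y (i + 1) - dentedWalk m X Y i = (-1, 0)) := by
  rcases Nat.lt_or_ge i (m + 2) with h1 | h1
  · have := h.dentedWalk_step_up (i := i) (by omega)
    have h2 : i ≤ m + 1 := by omega
    tauto
  rcases h1.eq_or_lt with rfl | h1
  · exact Or.inr (Or.inr (Or.inr (Or.inl ⟨le_rfl, by omega, h.dentedWalk_step_top⟩)))
  rcases Nat.lt_or_ge i (2 * m + 6) with h2 | h2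
  · have := h.dentedWalk_step_down h1 (by omega)
    have h3 : i ≤ 2 * m + 5 := by omega
    have h4 : m + 2 ≤ i := by omega
    tauto
  obtain rfl | rfl | rfl | rfl :
      i = 2 * m + 6 ∨ i = 2 * m + 7 ∨ i = 2 * m + 8 ∨ i = 2 * m + 9 := by omega
  · simp [h.dentedWalk_step_bottom]
  · simp [dentedWalk_add_seven, dentedWalk_add_eight]
  · simp [dentedWalk_add_eight, dentedWalk_add_nine]
  · simp [dentedWalk_add_nine, dentedWalk_add_ten]

theorem IsNestedPair.dentedWalk_cases (h : IsNestedPair m X Y) (i : ℕ) (hi : i < 2 * m + 10) :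
    (i ≤ m + 2 ∧ (dentedWalk m X Y i).1 = X (i - 1) ∧
      (dentedWalk m X Y i).2 = i - X (i - 1) ∧ (i = 0 → X (i - 1) = 0) ∧
      X (i - 1) ≤ i - 1 ∧ Y (i - 1) ≤ i - 1 ∧ (i ≤ m + 1 → Y (i - 1) ≤ X (i - 1))) ∨
    (m + 2 < i ∧ i ≤ 2 * m + 6 ∧ (dentedWalk m X Y i).1 = Y (2 * m + 3 - i) - 1 ∧
      (dentedWalk m X Y i).2 = 2 * m + 5 - i - Y (2 * m + 3 - i) ∧
      Y (2 * m + 3 - i) ≤ 2 * m + 3 - i) ∨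
    (i = 2 * m + 7 ∧ dentedWalk m X Y i = (0, -1)) ∨
    (i = 2 * m + 8 ∧ dentedWalk m X Y i = (1, -1)) ∨
    (i = 2 * m + 9 ∧ dentedWalk m X Y i = (1, 0)) := by
  rcases Nat.lt_or_ge i (m + 3) with h1 | h1
  · have h2 := dentedWalk_of_le (m := m) (X := X) (Y := Y) (i := i) (by omega)
    refine Or.inl ⟨by omega, h2.1, h2.2, ?_, h.fst_le _, h.snd_le _, fun _ => h.le _ (by omega)⟩
    rintro rfl
    exact h.fst_zero
  rcases Nat.lt_or_ge i (2 * m + 7) with h2 | h2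
  · have h3 := dentedWalk_of_lt_of_le (m := m) (X := X) (Y := Y) (i := i) (by omega) (by omega)
    exact Or.inr (Or.inl ⟨by omega, by omega, h3.1, h3.2, h.snd_le _⟩)
  obtain rfl | rfl | rfl : i = 2 * m + 7 ∨ i = 2 * m + 8 ∨ i = 2 * m + 9 := by omega
  · simp [dentedWalk_add_seven]
  · simp [dentedWalk_add_eight]
  · simp [dentedWalk_add_nine]

theorem IsNestedPair.dentedWalk_injOn (h : IsNestedPair m X Y) {i j : ℕ} (hi : i < 2 * m + 10)
    (hj : j < 2 * m + 10) (hij : dentedWalk m X Y i = dentedWalk m X Y j) : i = j := by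
  wlog hle : i ≤ j generalizing i j
  · exact (this hj hi hij.symm (by omega)).symm
  have h1 := h.dentedWalk_cases i hi
  have h2 := h.dentedWalk_cases j hj
  have h3 : j = 2 * m + 4 - i → 2 * m + 3 - j = i - 1 := by omega
  by_cases hs : j = 2 * m + 4 - i
  · rw [h3 hs] at h2
    simp only [Prod.ext_iff] at h1 h2 hij
    omega
  · simp only [Prod.ext_iff] at h1 h2 hij
    omega

theorem IsNestedPair.isThreeChoicePolygon (h : IsNestedPair m X Y) :
    IsThreeChoicePolygon (m + 5) (fun i => dentedWalk m X Y i) := by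
  have hstep : ∀ i : Fin (2 * (m + 5)),
      walkStep (2 * (m + 5)) (fun i => dentedWalk m X Y i) i =
        dentedWalk m X Y (i + 1) - dentedWalk m X Y i := fun i => rfl
  refine ⟨?_, ?_, ?_, ?_, ?_⟩
  · have := dentedWalk_of_le (m := m) (X := X) (Y := Y) (i := 0) (by omega)
    rw [Nat.zero_sub, h.fst_zero] at this
    simpa [Prod.ext_iff] using this
  · exact dentedWalk_add_ten
  · intro i
    rw [hstep]
    have := h.dentedWalk_step_cases (i := i) (by omega)
    simp only [Set.mem_insert_iff, Set.mem_singleton_iff]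
    tauto
  · intro i j hij
    exact Fin.ext (h.dentedWalk_injOn (by omega) (by omega) hij)
  · intro i j hij
    rw [hstep, hstep, hij]
    have h1 := h.dentedWalk_step_cases (i := i) (by omega)
    have h2 := h.dentedWalk_step_cases (i := i + 1) (by omega)
    simp only [Prod.ext_iff] at h1 h2 ⊢
    omega

/-- The vertices incident to a set of lattice edges. -/
def edgeVertices (E : Set (Sym2 (ℤ × ℤ))) : Set (ℤ × ℤ) := {z | ∃ e ∈ E, z ∈ e}

theorem mem_edgeVertices_translateEdges {v z : ℤ × ℤ} {E : Set (Sym2 (ℤ × ℤ))} :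
    z ∈ edgeVertices (translateEdges v E) ↔ z - v ∈ edgeVertices E := by
  constructor
  · rintro ⟨_, ⟨e, he, rfl⟩, hz⟩
    obtain ⟨y, hy, rfl⟩ := Sym2.mem_map.1 hz
    exact ⟨e, he, by simpa using hy⟩
  · rintro ⟨e, he, hz⟩
    exact ⟨_, ⟨e, he, rfl⟩, Sym2.mem_map.2 ⟨_, hz, sub_add_cancel z v⟩⟩

theorem mem_edgeVertices_pathEdges {n : ℕ} {p : Fin (n + 1) → ℤ × ℤ} {z : ℤ × ℤ}
    (hz : z ∈ edgeVertices (pathEdges n p)) : ∃ i, p i = z := by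
  obtain ⟨_, ⟨i, rfl⟩, hz⟩ := hz
  rcases Sym2.mem_iff.1 hz with h | h
  · exact ⟨_, h.symm⟩
  · exact ⟨_, h.symm⟩

theorem mem_edgeVertices_dentedWalk {z : ℤ × ℤ} :
    z ∈ edgeVertices (polygonEdges (m + 5) (fun i => dentedWalk m X Y i)) ↔
      ∃ i ≤ 2 * m + 10, dentedWalk m X Y i = z := by
  constructor
  · intro h
    obtain ⟨i, hi⟩ := mem_edgeVertices_pathEdges (n := 2 * (m + 5))
      (p := fun i => dentedWalk m X Y i) h
    exact ⟨i, by omega, hi⟩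
  · rintro ⟨i, hi, rfl⟩
    rcases hi.lt_or_eq with hi | rfl
    · exact ⟨_, ⟨⟨i, by omega⟩, rfl⟩, Sym2.mem_mk_left _ _⟩
    · exact ⟨_, ⟨⟨2 * m + 9, by omega⟩, rfl⟩, Sym2.mem_mk_right _ _⟩

theorem IsNestedPair.exists_lt_of_mem_edgeVertices (h : IsNestedPair m X Y) {z : ℤ × ℤ}
    (hz : z ∈ edgeVertices (polygonEdges (m + 5) (fun i => dentedWalk m X Y i))) :
    ∃ i < 2 * m + 10, dentedWalk m X Y i = z := by
  obtain ⟨i, hi, rfl⟩ := mem_edgeVertices_dentedWalk.1 hz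
  rcases hi.lt_or_eq with hi | rfl
  · exact ⟨i, hi, rfl⟩
  · exact ⟨0, by omega, h.isThreeChoicePolygon.1.trans h.isThreeChoicePolygon.2.1.symm⟩

/-- A staircase polygon has at most two vertices on each antidiagonal. -/
theorem IsStaircaseTranslate.eq_or_eq_or_eq {E : Set (Sym2 (ℤ × ℤ))} (hE : IsStaircaseTranslate E)
    {a b c : ℤ × ℤ} (ha : a ∈ edgeVertices E) (hb : b ∈ edgeVertices E) (hc : c ∈ edgeVertices E)
    (hab : a.1 + a.2 = b.1 + b.2) (hac : a.1 + a.2 = c.1 + c.2) : a = b ∨ a = c ∨ b = c := by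
  obtain ⟨v, _, ⟨n, p, q, hpq, rfl⟩, rfl⟩ := hE
  obtain ⟨hp, hq, hp0, hq0, -⟩ := hpq
  have hmem : ∀ z, z ∈ edgeVertices (translateEdges v (pathEdges n p ∪ pathEdges n q)) →
      ∃ i : Fin (n + 1), (i : ℤ) = z.1 + z.2 - (v.1 + v.2) ∧ (p i = z - v ∨ q i = z - v) := by
    intro z hz
    obtain ⟨e, he | he, hz⟩ := mem_edgeVertices_translateEdges.1 hz
    · obtain ⟨i, hi⟩ := mem_edgeVertices_pathEdges ⟨e, he, hz⟩
      refine ⟨i, ?_, Or.inl hi⟩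
      rw [← hp.level hp0 i, hi, Prod.fst_sub, Prod.snd_sub]
      ring
    · obtain ⟨i, hi⟩ := mem_edgeVertices_pathEdges ⟨e, he, hz⟩
      refine ⟨i, ?_, Or.inr hi⟩
      rw [← hq.level hq0 i, hi, Prod.fst_sub, Prod.snd_sub]
      ring
  obtain ⟨i, hi, ha⟩ := hmem a ha
  obtain ⟨j, hj, hb⟩ := hmem b hb
  obtain ⟨k, hk, hc⟩ := hmem c hc
  obtain rfl : i = j := Fin.ext (by omega)
  obtain rfl : i = k := Fin.ext (by omega)
  have hsub : ∀ {x y u : ℤ × ℤ}, u = x - v → u = y - v → x = y := fun h1 h2 =>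
    sub_left_injective (h1.symm.trans h2)
  rcases ha with ha | ha <;> rcases hb with hb | hb <;> rcases hc with hc | hc <;>
    first
    | exact Or.inl (hsub ha hb)
    | exact Or.inr (Or.inl (hsub ha hc))
    | exact Or.inr (Or.inr (hsub hb hc))

theorem IsNestedPair.dentedWalk_add_four (h : IsNestedPair m X Y) :
    dentedWalk m X Y (2 * m + 4) = (-1, 1) := by
  have := dentedWalk_of_lt_of_le (m := m) (X := X) (Y := Y) (i := 2 * m + 4) (by omega) (by omega)
  rw [show 2 * m + 3 - (2 * m + 4) = 0 by omega, h.snd_zero] at this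
  rw [Prod.ext_iff]
  omega

theorem IsNestedPair.dentedWalk_add_six (h : IsNestedPair m X Y) :
    dentedWalk m X Y (2 * m + 6) = (-1, -1) := by
  have := dentedWalk_of_lt_of_le (m := m) (X := X) (Y := Y) (i := 2 * m + 6) (by omega) (by omega)
  rw [show 2 * m + 3 - (2 * m + 6) = 0 by omega, h.snd_zero] at this
  rw [Prod.ext_iff]
  omega

theorem IsNestedPair.not_isStaircaseTranslate (h : IsNestedPair m X Y) :
    ¬ IsStaircaseTranslate (polygonEdges (m + 5) (fun i => dentedWalk m X Y i)) := by
  intro hE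
  have h1 := hE.eq_or_eq_or_eq (a := (0, 0)) (b := (1, -1)) (c := (-1, 1))
    (mem_edgeVertices_dentedWalk.2 ⟨_, le_rfl, dentedWalk_add_ten⟩)
    (mem_edgeVertices_dentedWalk.2 ⟨2 * m + 8, by omega, dentedWalk_add_eight⟩)
    (mem_edgeVertices_dentedWalk.2 ⟨2 * m + 4, by omega, h.dentedWalk_add_four⟩) rfl rfl
  simp at h1

/-- On high antidiagonals the vertices of the dented polygon are those of its two long sides. -/
theorem IsNestedPair.eq_or_eq_of_mem_edgeVertices (h : IsNestedPair m X Y) {z : ℤ × ℤ} {t : ℕ}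
    (hz : z ∈ edgeVertices (polygonEdges (m + 5) (fun i => dentedWalk m X Y i)))
    (ht : t ≤ m) (ht0 : 0 < t) (hlev : z.1 + z.2 = t + 1) : z.1 = X t ∨ z.1 = Y t - 1 := by
  obtain ⟨i, hi, rfl⟩ := h.exists_lt_of_mem_edgeVertices hz
  have h1 := h.dentedWalk_cases i hi
  have h2 : i = t + 1 ∨ i = 2 * m + 3 - t := by
    simp only [Prod.ext_iff] at h1
    omega
  rcases h2 with rfl | rfl
  · rw [Nat.add_sub_cancel] at h1
    simp only [Prod.ext_iff] at h1
    omega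
  · rw [show 2 * m + 3 - (2 * m + 3 - t) = t by omega] at h1
    simp only [Prod.ext_iff] at h1
    omega

theorem IsNestedPair.lowest (h : IsNestedPair m X Y) {z : ℤ × ℤ}
    (hz : z ∈ edgeVertices (polygonEdges (m + 5) (fun i => dentedWalk m X Y i))) :
    -2 ≤ z.1 + z.2 ∧ (z.1 + z.2 = -2 → z = (-1, -1)) := by
  obtain ⟨i, hi, rfl⟩ := h.exists_lt_of_mem_edgeVertices hz
  have h1 := h.dentedWalk_cases i hi
  simp only [Prod.ext_iff] at h1 ⊢
  omega

theorem mem_edgeVertices_fst {t : ℕ} (ht : t ≤ m) : ((X t : ℤ), (t : ℤ) + 1 - X t) ∈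
    edgeVertices (polygonEdges (m + 5) (fun i => dentedWalk m X Y i)) := by
  refine mem_edgeVertices_dentedWalk.2 ⟨t + 1, by omega, ?_⟩
  have := dentedWalk_of_le (m := m) (X := X) (Y := Y) (i := t + 1) (by omega)
  rw [Prod.ext_iff]
  simpa using this

theorem mem_edgeVertices_snd {t : ℕ} (ht : t ≤ m) : ((Y t : ℤ) - 1, (t : ℤ) + 2 - Y t) ∈
    edgeVertices (polygonEdges (m + 5) (fun i => dentedWalk m X Y i)) := by
  refine mem_edgeVertices_dentedWalk.2 ⟨2 * m + 3 - t, by omega, ?_⟩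
  have := dentedWalk_of_lt_of_le (m := m) (X := X) (Y := Y) (i := 2 * m + 3 - t) (by omega)
    (by omega)
  rw [show 2 * m + 3 - (2 * m + 3 - t) = t by omega] at this
  rw [Prod.ext_iff]
  omega

/-- A dented polygon is determined, up to translation, by its edge set. -/
theorem IsNestedPair.eq_of_transEquiv {X' Y' : ℕ → ℕ} (h : IsNestedPair m X Y)
    (h' : IsNestedPair m X' Y')
    (hE : TransEquiv (polygonEdges (m + 5) (fun i => dentedWalk m X Y i))
      (polygonEdges (m + 5) (fun i => dentedWalk m X' Y' i))) :
    ∀ t ≤ m, X t = X' t ∧ Y t = Y' t := by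
  obtain ⟨v, hv⟩ := hE
  have hmem : ∀ z, z ∈ edgeVertices (polygonEdges (m + 5) (fun i => dentedWalk m X' Y' i)) ↔
      z - v ∈ edgeVertices (polygonEdges (m + 5) (fun i => dentedWalk m X Y i)) := fun z => by
    rw [hv, mem_edgeVertices_translateEdges]
  have hv0 : v = 0 := by
    have h1 : ((-1, -1) : ℤ × ℤ) ∈
        edgeVertices (polygonEdges (m + 5) (fun i => dentedWalk m X Y i)) :=
      mem_edgeVertices_dentedWalk.2 ⟨2 * m + 6, by omega, h.dentedWalk_add_six⟩
    have h2 : ((-1, -1) : ℤ × ℤ) ∈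
        edgeVertices (polygonEdges (m + 5) (fun i => dentedWalk m X' Y' i)) :=
      mem_edgeVertices_dentedWalk.2 ⟨2 * m + 6, by omega, h'.dentedWalk_add_six⟩
    have h3 := h.lowest ((hmem _).1 h2)
    have h4 := h'.lowest ((hmem ((-1, -1) + v)).2 (by simpa using h1))
    simp only [Prod.ext_iff, Prod.fst_sub, Prod.snd_sub, Prod.fst_add, Prod.snd_add] at h3 h4
    rw [Prod.ext_iff]
    simp only [Prod.fst_zero, Prod.snd_zero]
    omega
  simp only [hv0, sub_zero] at hmem
  intro t ht
  rcases Nat.eq_zero_or_pos t with rfl | ht0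
  · exact ⟨h.fst_zero.trans h'.fst_zero.symm, h.snd_zero.trans h'.snd_zero.symm⟩
  have e1 := h'.eq_or_eq_of_mem_edgeVertices ((hmem _).2 (mem_edgeVertices_fst ht)) ht ht0
    (by ring)
  have e2 := h'.eq_or_eq_of_mem_edgeVertices ((hmem _).2 (mem_edgeVertices_snd ht)) ht ht0
    (by ring)
  have e3 := h.eq_or_eq_of_mem_edgeVertices ((hmem _).1 (mem_edgeVertices_fst ht)) ht ht0
    (by ring)
  have e4 := h.eq_or_eq_of_mem_edgeVertices ((hmem _).1 (mem_edgeVertices_snd ht)) ht ht0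
    (by ring)
  have := h.le t ht
  have := h'.le t ht
  simp only at e1 e2 e3 e4
  omega

end DentedWalk

theorem transEquiv_refl (E : Set (Sym2 (ℤ × ℤ))) : TransEquiv E E :=
  ⟨0, by simp [translateEdges]⟩

theorem exists_imperfectCode (n : ℕ) : ∃ f : {C : Set (Set (Sym2 (ℤ × ℤ))) //
    ∃ w : Fin (2 * n + 1) → ℤ × ℤ, IsThreeChoicePolygon n w ∧
      ¬ IsStaircaseTranslate (polygonEdges n w) ∧
      C = {F | TransEquiv (polygonEdges n w) F}} →
    {w : Fin (2 * n + 1) → ℤ × ℤ // IsThreeChoicePolygon n w}, Function.Injective f := by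
  choose w hw _ hC using fun C : {C : Set (Set (Sym2 (ℤ × ℤ))) //
    ∃ w : Fin (2 * n + 1) → ℤ × ℤ, IsThreeChoicePolygon n w ∧
      ¬ IsStaircaseTranslate (polygonEdges n w) ∧
      C = {F | TransEquiv (polygonEdges n w) F}} => C.2
  refine ⟨fun C => ⟨w C, hw C⟩, fun C C' h => ?_⟩
  have h1 : w C = w C' := congrArg Subtype.val h
  rw [Subtype.ext_iff, hC C, hC C', h1]

instance finite_imperfect (n : ℕ) : Finite {C : Set (Set (Sym2 (ℤ × ℤ))) //
    ∃ w : Fin (2 * n + 1) → ℤ × ℤ, IsThreeChoicePolygon n w ∧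
      ¬ IsStaircaseTranslate (polygonEdges n w) ∧
      C = {F | TransEquiv (polygonEdges n w) F}} := by
  obtain ⟨f, hf⟩ := exists_imperfectCode n
  exact Finite.of_injective f hf

theorem imperfectCount_le_threeChoicePolygonCount (n : ℕ) :
    imperfectCount n ≤ threeChoicePolygonCount n := by
  obtain ⟨f, hf⟩ := exists_imperfectCode n
  exact Nat.card_le_card_of_injective f hf

theorem catalan_le_imperfectCount (m : ℕ) : catalan m ≤ imperfectCount (m + 5) := by
  rw [← DyckWord.card_dyckWord_semilength_eq_catalan, ← Nat.card_eq_fintype_card, imperfectCount]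
  have hpair : ∀ D : {p : DyckWord // p.semilength = m},
      IsNestedPair m D.1.evenUps D.1.oddDowns := fun D => by
    have := D.1.isNestedPair
    rwa [D.2] at this
  refine Nat.card_le_card_of_injective (fun D => ⟨_, _, (hpair D).isThreeChoicePolygon,
    (hpair D).not_isStaircaseTranslate, rfl⟩) ?_
  intro D D' h
  have h1 := Subtype.ext_iff.1 h
  have h2 : TransEquiv (polygonEdges (m + 5) fun i => dentedWalk m D.1.evenUps D.1.oddDowns i)
      (polygonEdges (m + 5) fun i => dentedWalk m D'.1.evenUps D'.1.oddDowns i) :=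
    (Set.ext_iff.1 h1 _).2 (transEquiv_refl _)
  have h3 := (hpair D).eq_of_transEquiv (hpair D') h2
  exact Subtype.ext (DyckWord.eq_of_evenUps_eq_of_oddDowns_eq D.2 D'.2
    (fun i hi => (h3 i hi).1) (fun i hi => (h3 i hi).2))

/-- The sequences `t_n`, `p_n` and `c_n` all grow like `4^n`:
their `n`-th root each tends to `4`. -/
theorem threeChoice_growth_four :
    Filter.Tendsto (fun n : ℕ => (threeChoicePolygonCount n : ℝ) ^ (1 / (n : ℝ)))
      Filter.atTop (nhds 4) ∧
    Filter.Tendsto (fun n : ℕ => (imperfectCount n : ℝ) ^ (1 / (n : ℝ)))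
      Filter.atTop (nhds 4) ∧
    Filter.Tendsto (fun n : ℕ => (staircaseCount n : ℝ) ^ (1 / (n : ℝ)))
      Filter.atTop (nhds 4) := by
  have hpos : ∀ n, (0 : ℝ) < subexpFactor n := fun n => by exact_mod_cast subexpFactor_pos n
  have hlow : ∀ {a : ℕ → ℕ} (k : ℕ), k ≤ 5 → (∀ m, catalan m ≤ a (m + k)) →
      ∀ᶠ n in Filter.atTop, (4 : ℝ) ^ n / subexpFactor n ≤ a n := by
    intro a k hk ha
    filter_upwards [Filter.eventually_ge_atTop (k + 1)] with n hn
    have h1 := ha (n - k)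
    rw [Nat.sub_add_cancel (by omega)] at h1
    rw [div_le_iff₀ (hpos n)]
    exact_mod_cast (four_pow_le_subexpFactor_mul_catalan (by omega) (by omega) (by omega)).trans
      (Nat.mul_le_mul_right (subexpFactor n) h1)
  have hup : ∀ {a : ℕ → ℕ}, (∀ n, 1 ≤ n → a n ≤ 4 ^ n * subexpFactor n) →
      ∀ᶠ n in Filter.atTop, (a n : ℝ) ≤ (4 : ℝ) ^ n * subexpFactor n := by
    intro a ha
    filter_upwards [Filter.eventually_ge_atTop 1] with n hn
    exact_mod_cast ha n hn
  refine ⟨tendsto_root_four hpos tendsto_subexpFactor_root ?_ ?_,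
    tendsto_root_four hpos tendsto_subexpFactor_root ?_ ?_,
    tendsto_root_four hpos tendsto_subexpFactor_root ?_ ?_⟩
  · exact hlow 5 le_rfl fun m =>
      (catalan_le_imperfectCount m).trans (imperfectCount_le_threeChoicePolygonCount _)
  · exact hup fun n hn => threeChoicePolygonCount_le hn
  · exact hlow 5 le_rfl catalan_le_imperfectCount
  · exact hup fun n hn =>
      (imperfectCount_le_threeChoicePolygonCount n).trans (threeChoicePolygonCount_le hn)
  · exact hlow 2 (by norm_num) catalan_le_staircaseCount
  · exact hup fun n _ =>
      (staircaseCount_le n).trans (Nat.le_mul_of_pos_right _ (subexpFactor_pos n))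
end
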